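/- arXiv:0807.3578 — 2 statements merged into one kernel-verified Lean document; each statement's English description precedes it below -/
import Mathlib

section
/- Let f ∈ ℂ[X] have degree n > 1 and put G := Mon(f). Then G is a cyclic group if and only if f is cyclic, in which case |G| = n. Likewise, if n > 2, then G is isomorphic to a dihedral group if and only if f is dihedral, in which case |G| = 2n (so G is isomorphic to the dihedral group of order 2n). -/
open Polynomial

/-- The normalized degree-`n` Chebyshev polynomial `T_n`, characterized by
`T_n(Y + 1/Y) = Y^n + 1/Y^n`; it is the Dickson polynomial `D_n(X, 1)`
of the first kind. -/
noncomputable def chebT (n : ℕ) : ℂ[X] :=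
  Polynomial.dickson 1 (1 : ℂ) n

/-- The polynomial `u(X) - t` over the rational function field `ℂ(t)`;
its Galois group `(monPoly u).Gal` is the monodromy group `Mon(u)`. -/
noncomputable def monPoly (u : ℂ[X]) : Polynomial (RatFunc ℂ) :=
  u.map (RatFunc.C) - Polynomial.C RatFunc.X

/-- `f` is cyclic: equivalent (by composing with linears) to `X^n` for some `n > 1`. -/
def CyclicPoly (f : ℂ[X]) : Prop :=
  ∃ n : ℕ, 1 < n ∧ ∃ ℓ₁ ℓ₂ : ℂ[X], ℓ₁.natDegree = 1 ∧ ℓ₂.natDegree = 1 ∧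
    f = ℓ₁.comp ((Polynomial.X ^ n).comp ℓ₂)

/-- `f` is dihedral: equivalent (by composing with linears) to `T_n` for some `n > 2`. -/
def DihedralPoly (f : ℂ[X]) : Prop :=
  ∃ n : ℕ, 2 < n ∧ ∃ ℓ₁ ℓ₂ : ℂ[X], ℓ₁.natDegree = 1 ∧ ℓ₂.natDegree = 1 ∧
    f = ℓ₁.comp ((chebT n).comp ℓ₂)

section FunctionField

open IntermediateField.algebraAdjoinAdjoin

variable {k L : Type*} [Field k] [Field L] [Algebra k L]

/-- The polynomial ring `k[x]` is integrally closed in its fraction field `k(x)`. -/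
lemma exists_aeval_eq_of_isIntegral {x w : L} (hx : Transcendental k x)
    (hw : w ∈ IntermediateField.adjoin k {x}) (hi : IsIntegral (Algebra.adjoin k {x}) w) :
    ∃ p : k[X], aeval x p = w := by
  have : IsIntegrallyClosed (Algebra.adjoin k {x}) :=
    IsIntegrallyClosed.of_equiv (Polynomial.algEquivOfTranscendental k x hx).toRingEquiv
  have hi' : IsIntegral (Algebra.adjoin k {x}) (⟨w, hw⟩ : IntermediateField.adjoin k {x}) := by
    refine (isIntegral_algHom_iff (IsScalarTower.toAlgHom (Algebra.adjoin k {x})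
      (IntermediateField.adjoin k {x}) L) Subtype.val_injective).1 ?_
    exact hi
  obtain ⟨y, hy⟩ := IsIntegrallyClosed.isIntegral_iff.1 hi'
  obtain ⟨p, hp⟩ := (Algebra.adjoin_singleton_eq_range_aeval k x).le y.2
  exact ⟨p, hp.trans (congrArg Subtype.val hy)⟩

/-- A bound on the pole order at infinity of a polynomial in `x` bounds its degree. -/
lemma natDegree_le_of_isIntegral_div_pow {x : L} (hx : Transcendental k x) {p : k[X]} {d : ℕ}
    (hi : IsIntegral (Algebra.adjoin k {x⁻¹}) (aeval x p / x ^ d)) : p.natDegree ≤ d := by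
  have hx0 : x ≠ 0 := by rintro rfl; exact hx isAlgebraic_zero
  have hxi : Transcendental k x⁻¹ := fun h ↦ hx (by simpa using h.inv)
  have hmem : x ∈ IntermediateField.adjoin k {x⁻¹} := by
    simpa using inv_mem (IntermediateField.mem_adjoin_simple_self k x⁻¹)
  have haev : aeval x p ∈ IntermediateField.adjoin k {x⁻¹} := by
    rw [aeval_eq_sum_range]
    exact sum_mem fun i _ ↦ IntermediateField.smul_mem _ (pow_mem hmem i)
  obtain ⟨q, hq⟩ := exists_aeval_eq_of_isIntegral hxi (div_mem haev (pow_mem hmem d)) hi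
  have hrev : aeval x q.reverse = x ^ q.natDegree * aeval x⁻¹ q := by
    let := invertibleOfNonzero (inv_ne_zero hx0)
    have := eval₂_reverse_mul_pow (algebraMap k L) x⁻¹ q
    rw [invOf_eq_inv, inv_inv] at this
    rw [aeval_def, aeval_def, ← this, mul_comm, mul_assoc, ← mul_pow, inv_mul_cancel₀ hx0,
      one_pow, mul_one]
  have hpoly : X ^ q.natDegree * p = X ^ d * q.reverse := by
    refine transcendental_iff_injective.1 hx ?_
    simp only [map_mul, map_pow, aeval_X, hrev, hq]
    field_simp
  by_cases hp : p = 0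
  · simp [hp]
  have hq0 : q.reverse ≠ 0 := by
    rintro h
    rw [h, mul_zero] at hpoly
    exact (mul_ne_zero (pow_ne_zero _ X_ne_zero) hp) hpoly
  have := congrArg natDegree hpoly
  rw [natDegree_mul (pow_ne_zero _ X_ne_zero) hp, natDegree_mul (pow_ne_zero _ X_ne_zero) hq0,
    natDegree_X_pow, natDegree_X_pow] at this
  have := reverse_natDegree_le q
  omega

/-- An element `y` with `f(y)` integral over an extension of the constants is integral. -/
lemma isIntegral_of_aeval {A : Subalgebra k L} {f : k[X]} (hf : f.natDegree ≠ 0) {y : L}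
    (hy : IsIntegral A (aeval y f)) : IsIntegral A y := by
  have hf0 : f ≠ 0 := by rintro rfl; simp at hf
  have hmon : (C f.leadingCoeff⁻¹ * f).Monic := by
    rw [mul_comm]; exact monic_mul_leadingCoeff_inv hf0
  have hdeg : (C f.leadingCoeff⁻¹ * f).natDegree = f.natDegree :=
    natDegree_C_mul (inv_ne_zero (leadingCoeff_ne_zero.2 hf0))
  refine IsIntegral.of_aeval_monic (p := (C f.leadingCoeff⁻¹ * f).map (algebraMap k A))
    (hmon.map _) (by rwa [hmon.natDegree_map, hdeg]) ?_
  rw [aeval_map_algebraMap, map_mul, aeval_C]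
  exact (isIntegral_algebraMap (R := A) (A := L) (x := algebraMap k A f.leadingCoeff⁻¹)).mul hy

/-- If `f(y) = f(x)` then `y / x` is regular at infinity. -/
lemma isIntegral_div_of_aeval_eq {f : k[X]} (hf : f.natDegree ≠ 0) {x y : L} (hx0 : x ≠ 0)
    (hxy : aeval y f = aeval x f) : IsIntegral (Algebra.adjoin k {x⁻¹}) (y / x) := by
  have hf0 : f ≠ 0 := by rintro rfl; simp at hf
  set A := Algebra.adjoin k {x⁻¹}
  let v : A := ⟨x⁻¹, Algebra.self_mem_adjoin_singleton k x⁻¹⟩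
  set g := C f.leadingCoeff⁻¹ * f with hg
  have hmon : g.Monic := by
    rw [hg, mul_comm]; exact monic_mul_leadingCoeff_inv hf0
  have hdeg : g.natDegree = f.natDegree :=
    natDegree_C_mul (inv_ne_zero (leadingCoeff_ne_zero.2 hf0))
  have hgm : (g.map (algebraMap k A)).Monic := hmon.map _
  have key : ∀ z : L, aeval (z / x) (scaleRoots (g.map (algebraMap k A)) v) =
      (x⁻¹) ^ g.natDegree * aeval z g := by
    intro z
    have := scaleRoots_eval₂_mul (p := g.map (algebraMap k A)) (algebraMap A L) z v
    rw [← aeval_def, ← aeval_def, aeval_map_algebraMap, hmon.natDegree_map] at this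
    rw [div_eq_inv_mul]
    exact this
  refine IsIntegral.of_aeval_monic (p := scaleRoots (g.map (algebraMap k A)) v)
    ((monic_scaleRoots_iff v).2 hgm) (by rwa [natDegree_scaleRoots, hmon.natDegree_map, hdeg]) ?_
  have : aeval y g = aeval x g := by simp [hg, hxy]
  rw [key, this, ← key, div_self hx0, ← map_one (algebraMap A L), aeval_algebraMap_apply]
  exact isIntegral_algebraMap

end FunctionField

lemma irreducible_monPoly {f : ℂ[X]} (hf : f.natDegree ≠ 0) : Irreducible (monPoly f) := by
  have hf0 : f ≠ 0 := by rintro rfl; simp at hf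
  set P : ℂ[X][X] := f.map C - C X with hP
  have hmap : P.map (algebraMap ℂ[X] (RatFunc ℂ)) = monPoly f := by
    simp [hP, monPoly, Polynomial.map_map, RatFunc.algebraMap_comp_C]
  have hprim : P.IsPrimitive := by
    intro r hr
    rw [C_dvd_iff_dvd_coeff] at hr
    have := hr f.natDegree
    rw [hP, coeff_sub, coeff_map, coeff_C, if_neg hf, sub_zero] at this
    exact isUnit_of_dvd_unit this (isUnit_C.2 (isUnit_iff_ne_zero.2 (leadingCoeff_ne_zero.2 hf0)))
  rw [← hmap, ← hprim.irreducible_iff_irreducible_map_fraction_map,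
    ← MulEquiv.irreducible_iff (Bivariate.swap (R := ℂ))]
  have : Bivariate.swap (R := ℂ) P = -(X - C f) := by
    rw [hP, map_sub, Bivariate.swap_map_C, Bivariate.swap_X, neg_sub]
  rw [this]
  exact (Associated.refl (X - C f)).neg_left.irreducible_iff.2 (irreducible_X_sub_C f)

section Monodromy

variable {f : ℂ[X]} {L : Type*} [Field L] [Algebra ℂ L] [Algebra (RatFunc ℂ) L]
  [IsScalarTower ℂ (RatFunc ℂ) L]

lemma aeval_monPoly (f : ℂ[X]) (y : L) :
    aeval y (monPoly f) = aeval y f - algebraMap (RatFunc ℂ) L RatFunc.X := by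
  have : f.map RatFunc.C = f.map (algebraMap ℂ (RatFunc ℂ)) := rfl
  rw [monPoly, this, map_sub, aeval_map_algebraMap, aeval_C]

variable (L) in
lemma transcendental_algebraMap_X :
    Transcendental ℂ (algebraMap (RatFunc ℂ) L RatFunc.X) :=
  (transcendental_algebraMap_iff (algebraMap (RatFunc ℂ) L).injective).2 RatFunc.transcendental_X

lemma transcendental_root {x : L} (hx : aeval x f = algebraMap (RatFunc ℂ) L RatFunc.X) :
    Transcendental ℂ x :=
  (transcendental_aeval_iff.1 (hx ▸ transcendental_algebraMap_X L)).1

lemma algEquiv_algebraMap (σ : L ≃ₐ[RatFunc ℂ] L) (c : ℂ) :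
    σ (algebraMap ℂ L c) = algebraMap ℂ L c :=
  (σ.restrictScalars ℂ).commutes c

lemma aeval_algEquiv_apply (σ : L ≃ₐ[RatFunc ℂ] L) (p : ℂ[X]) (y : L) :
    aeval (σ y) p = σ (aeval y p) :=
  aeval_algHom_apply ((σ.restrictScalars ℂ) : L →ₐ[ℂ] L) y p

lemma aeval_algEquiv_root (σ : L ≃ₐ[RatFunc ℂ] L) {x : L}
    (hx : aeval x f = algebraMap (RatFunc ℂ) L RatFunc.X) :
    aeval (σ x) f = algebraMap (RatFunc ℂ) L RatFunc.X := by
  rw [aeval_algEquiv_apply, hx, σ.commutes]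

lemma algebraMap_mem_adjoin (u : RatFunc ℂ) : algebraMap (RatFunc ℂ) L u ∈
    IntermediateField.adjoin ℂ {algebraMap (RatFunc ℂ) L RatFunc.X} := by
  have hu : u ∈ IntermediateField.adjoin ℂ {(RatFunc.X : RatFunc ℂ)} := by
    rw [RatFunc.adjoin_X]; trivial
  have := IntermediateField.adjoin_map ℂ {(RatFunc.X : RatFunc ℂ)}
    (IsScalarTower.toAlgHom ℂ (RatFunc ℂ) L)
  rw [Set.image_singleton] at this
  exact this.le ⟨u, hu, rfl⟩

omit [IsScalarTower ℂ (RatFunc ℂ) L] in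
lemma isIntegral_root (hf : f.natDegree ≠ 0) {y : L}
    (hy : aeval y f = algebraMap (RatFunc ℂ) L RatFunc.X) :
    IsIntegral (Algebra.adjoin ℂ {algebraMap (RatFunc ℂ) L RatFunc.X}) y := by
  refine isIntegral_of_aeval hf ?_
  rw [hy]
  exact isIntegral_algebraMap (x := (⟨_, Algebra.self_mem_adjoin_singleton ℂ _⟩ :
    Algebra.adjoin ℂ {algebraMap (RatFunc ℂ) L RatFunc.X}))

omit [IsScalarTower ℂ (RatFunc ℂ) L] in
lemma isIntegral_root_adjoin_root (hf : f.natDegree ≠ 0) {x y : L}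
    (hx : aeval x f = algebraMap (RatFunc ℂ) L RatFunc.X)
    (hy : aeval y f = algebraMap (RatFunc ℂ) L RatFunc.X) :
    IsIntegral (Algebra.adjoin ℂ {x}) y := by
  refine isIntegral_of_aeval hf ?_
  rw [hy, ← hx]
  exact isIntegral_algebraMap (x := (⟨_, aeval_mem_adjoin_singleton ℂ x⟩ :
    Algebra.adjoin ℂ {x}))

lemma monPoly_ne_zero (hf : f.natDegree ≠ 0) : monPoly f ≠ 0 :=
  (irreducible_monPoly hf).ne_zero

lemma mem_rootSet_monPoly (hf : f.natDegree ≠ 0) {y : L} :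
    y ∈ (monPoly f).rootSet L ↔ aeval y f = algebraMap (RatFunc ℂ) L RatFunc.X := by
  rw [mem_rootSet_of_ne (monPoly_ne_zero hf), aeval_monPoly, sub_eq_zero]

lemma natDegree_monPoly (f : ℂ[X]) : (monPoly f).natDegree = f.natDegree := by
  rw [monPoly, natDegree_sub_C, natDegree_map]

variable [IsSplittingField (RatFunc ℂ) L (monPoly f)]

omit [Algebra ℂ L] [IsScalarTower ℂ (RatFunc ℂ) L] in
lemma ncard_rootSet_monPoly (hf : f.natDegree ≠ 0) :
    ((monPoly f).rootSet L).ncard = f.natDegree := by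
  rw [← natDegree_monPoly f, ← Nat.card_coe_set_eq, Nat.card_eq_fintype_card]
  exact card_rootSet_eq_natDegree (irreducible_monPoly hf).separable (IsSplittingField.splits L _)

lemma exists_root_monPoly (hf : f.natDegree ≠ 0) :
    ∃ x : L, aeval x f = algebraMap (RatFunc ℂ) L RatFunc.X := by
  have h := ncard_rootSet_monPoly (L := L) hf
  obtain ⟨x, hx⟩ := Set.nonempty_of_ncard_ne_zero (h.trans_ne hf)
  exact ⟨x, (mem_rootSet_monPoly hf).1 hx⟩

omit [Algebra ℂ L] [IsScalarTower ℂ (RatFunc ℂ) L] in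
lemma isGalois_monPoly (hf : f.natDegree ≠ 0) : IsGalois (RatFunc ℂ) L :=
  IsGalois.of_separable_splitting_field (p := monPoly f) (irreducible_monPoly hf).separable

lemma mem_adjoin_of_fixed (hf : f.natDegree ≠ 0) {w : L}
    (hw : ∀ σ : L ≃ₐ[RatFunc ℂ] L, σ w = w) :
    w ∈ IntermediateField.adjoin ℂ {algebraMap (RatFunc ℂ) L RatFunc.X} := by
  have := isGalois_monPoly (L := L) hf
  have := IsSplittingField.finiteDimensional L (monPoly f)
  obtain ⟨u, rfl⟩ := IntermediateField.mem_bot.1 ((IsGalois.mem_bot_iff_fixed w).2 hw)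
  exact algebraMap_mem_adjoin u

lemma mem_adjoin_root_of_fixed (hf : f.natDegree ≠ 0) {x w : L}
    (hx : aeval x f = algebraMap (RatFunc ℂ) L RatFunc.X)
    (hw : ∀ σ : L ≃ₐ[RatFunc ℂ] L, σ x = x → σ w = w) :
    w ∈ IntermediateField.adjoin ℂ {x} := by
  have := isGalois_monPoly (L := L) hf
  have := IsSplittingField.finiteDimensional L (monPoly f)
  have hle : IntermediateField.adjoin ℂ {algebraMap (RatFunc ℂ) L RatFunc.X} ≤
      IntermediateField.adjoin ℂ {x} := by
    rw [IntermediateField.adjoin_simple_le_iff, ← hx, aeval_eq_sum_range]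
    exact sum_mem fun i _ ↦ IntermediateField.smul_mem _
      (pow_mem (IntermediateField.mem_adjoin_simple_self ℂ x) i)
  let E : IntermediateField (RatFunc ℂ) L :=
    (IntermediateField.adjoin ℂ {x}).toSubfield.toIntermediateField
      fun u ↦ hle (algebraMap_mem_adjoin u)
  have hE : IntermediateField.adjoin (RatFunc ℂ) {x} ≤ E :=
    IntermediateField.adjoin_simple_le_iff.2 (IntermediateField.mem_adjoin_simple_self ℂ x)
  refine hE ?_
  rw [← IsGalois.fixedField_fixingSubgroup (IntermediateField.adjoin (RatFunc ℂ) {x})]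
  rintro ⟨σ, hσ⟩
  exact hw σ (hσ ⟨x, IntermediateField.mem_adjoin_simple_self _ x⟩)

lemma exists_algEquiv_root (hf : f.natDegree ≠ 0) {x y : L}
    (hx : aeval x f = algebraMap (RatFunc ℂ) L RatFunc.X)
    (hy : aeval y f = algebraMap (RatFunc ℂ) L RatFunc.X) :
    ∃ σ : L ≃ₐ[RatFunc ℂ] L, σ x = y := by
  have := isGalois_monPoly (L := L) hf
  have hx' : aeval x (monPoly f) = 0 := by rw [aeval_monPoly, hx, sub_self]
  have hy' : aeval y (monPoly f) = 0 := by rw [aeval_monPoly, hy, sub_self]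
  have : IsConjRoot (RatFunc ℂ) y x := by
    rw [isConjRoot_def, ← minpoly.eq_of_irreducible (irreducible_monPoly hf) hx',
      ← minpoly.eq_of_irreducible (irreducible_monPoly hf) hy']
  exact this.exists_algEquiv

lemma algEquiv_eq_one (hf : f.natDegree ≠ 0) {σ : L ≃ₐ[RatFunc ℂ] L}
    (h : ∀ y : L, aeval y f = algebraMap (RatFunc ℂ) L RatFunc.X → σ y = y) : σ = 1 := by
  have htop := IsSplittingField.adjoin_rootSet L (monPoly f)
  have := AlgHom.ext_of_adjoin_eq_top htop (φ₁ := (σ : L →ₐ[RatFunc ℂ] L))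
    (φ₂ := AlgHom.id _ _) fun y hy ↦ h y ((mem_rootSet_monPoly hf).1 hy)
  ext y
  exact DFunLike.congr_fun this y

lemma exists_polynomial_of_fixed (hf : f.natDegree ≠ 0) {x w : L} {d : ℕ}
    (hx : aeval x f = algebraMap (RatFunc ℂ) L RatFunc.X)
    (hw : ∀ σ : L ≃ₐ[RatFunc ℂ] L, σ x = x → σ w = w)
    (hi : IsIntegral (Algebra.adjoin ℂ {x}) w)
    (hd : IsIntegral (Algebra.adjoin ℂ {x⁻¹}) (w / x ^ d)) :
    ∃ p : ℂ[X], p.natDegree ≤ d ∧ aeval x p = w := by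
  have htr := transcendental_root hx
  obtain ⟨p, hp⟩ :=
    exists_aeval_eq_of_isIntegral htr (mem_adjoin_root_of_fixed hf hx hw) hi
  exact ⟨p, natDegree_le_of_isIntegral_div_pow htr (hp ▸ hd), hp⟩

lemma exists_linear_of_fixed (hf : f.natDegree ≠ 0) {x w : L}
    (hx : aeval x f = algebraMap (RatFunc ℂ) L RatFunc.X)
    (hw : ∀ σ : L ≃ₐ[RatFunc ℂ] L, σ x = x → σ w = w)
    (hi : IsIntegral (Algebra.adjoin ℂ {x}) w)
    (hd : IsIntegral (Algebra.adjoin ℂ {x⁻¹}) (w / x)) :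
    ∃ a b : ℂ, w = algebraMap ℂ L a * x + algebraMap ℂ L b := by
  obtain ⟨p, hp, rfl⟩ := exists_polynomial_of_fixed (d := 1) hf hx hw hi (by rwa [pow_one])
  obtain ⟨a, b, rfl⟩ := exists_eq_X_add_C_of_natDegree_le_one hp
  exact ⟨a, b, by simp⟩

/-- A polynomial in `x` of degree `deg f` which lies in `ℂ[t]` is `f` up to a linear change. -/
lemma exists_linear_comp_eq (hf : f.natDegree ≠ 0) {x w : L} {h : ℂ[X]}
    (hx : aeval x f = algebraMap (RatFunc ℂ) L RatFunc.X)
    (hw : ∀ σ : L ≃ₐ[RatFunc ℂ] L, σ w = w)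
    (hi : IsIntegral (Algebra.adjoin ℂ {algebraMap (RatFunc ℂ) L RatFunc.X}) w)
    (hh : aeval x h = w) (hdeg : h.natDegree = f.natDegree) :
    ∃ l : ℂ[X], l.natDegree = 1 ∧ f = l.comp h := by
  obtain ⟨Q, hQ⟩ := exists_aeval_eq_of_isIntegral (transcendental_algebraMap_X L)
    (mem_adjoin_of_fixed hf hw) hi
  have hcomp : Q.comp f = h := by
    refine transcendental_iff_injective.1 (transcendental_root hx) ?_
    rw [aeval_comp, hx, hQ, hh]
  have hQ1 : Q.natDegree = 1 := by
    have := congrArg natDegree hcomp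
    rw [natDegree_comp, hdeg] at this
    exact (Nat.mul_eq_right hf).1 this
  obtain ⟨a, b, rfl⟩ := exists_eq_X_add_C_of_natDegree_le_one hQ1.le
  have ha : a ≠ 0 := by
    rintro rfl
    simp at hQ1
  refine ⟨C a⁻¹ * X + C (-(a⁻¹ * b)), natDegree_linear (inv_ne_zero ha), ?_⟩
  rw [← hcomp]
  simp only [add_comp, mul_comp, C_comp, X_comp]
  have : (C a⁻¹ * C a : ℂ[X]) = 1 := by rw [← C_mul, inv_mul_cancel₀ ha, C_1]
  rw [C_neg, C_mul]
  linear_combination (-f) * this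

omit [IsScalarTower ℂ (RatFunc ℂ) L] [IsSplittingField (RatFunc ℂ) L (monPoly f)] in
lemma eq_zero_of_translation {σ : L ≃ₐ[RatFunc ℂ] L} {n : ℕ} (hn : n ≠ 0) (hσ : σ ^ n = 1)
    {v c : L} (hv : σ v = v + c) (hc : σ c = c) : c = 0 := by
  have key : ∀ k : ℕ, (σ ^ k) v = v + k * c := by
    intro k
    induction k with
    | zero => simp
    | succ k ih =>
      rw [pow_succ', AlgEquiv.mul_apply, ih, map_add, map_mul, hv, hc, map_natCast]
      push_cast
      ring
  have h := key n
  rw [hσ, AlgEquiv.one_apply, left_eq_add] at h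
  have : CharZero L := charZero_of_injective_algebraMap (algebraMap ℂ L).injective
  exact (mul_eq_zero.1 h).resolve_left (Nat.cast_ne_zero.2 hn)

lemma card_algEquiv_of_regular (hf : f.natDegree ≠ 0) {x : L}
    (hx : aeval x f = algebraMap (RatFunc ℂ) L RatFunc.X)
    (hreg : ∀ σ : L ≃ₐ[RatFunc ℂ] L, σ x = x → σ = 1) :
    Nat.card (L ≃ₐ[RatFunc ℂ] L) = f.natDegree := by
  rw [← ncard_rootSet_monPoly (L := L) hf, ← Nat.card_coe_set_eq]
  refine Nat.card_eq_of_bijective (fun σ : L ≃ₐ[RatFunc ℂ] L ↦ (⟨σ x, (mem_rootSet_monPoly hf).2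
    (aeval_algEquiv_root σ hx)⟩ : (monPoly f).rootSet L)) ⟨fun σ τ h ↦ ?_, fun y ↦ ?_⟩
  · have h' : σ x = τ x := congrArg Subtype.val h
    refine (inv_mul_eq_one.1 (hreg (σ⁻¹ * τ) ?_))
    rw [AlgEquiv.mul_apply, ← h', ← AlgEquiv.mul_apply, inv_mul_cancel, AlgEquiv.one_apply]
  · obtain ⟨σ, hσ⟩ := exists_algEquiv_root hf hx ((mem_rootSet_monPoly hf).1 y.2)
    exact ⟨σ, Subtype.ext hσ⟩

lemma regular_of_isCyclic [hc : IsCyclic (L ≃ₐ[RatFunc ℂ] L)] (hf : f.natDegree ≠ 0) {x : L}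
    (hx : aeval x f = algebraMap (RatFunc ℂ) L RatFunc.X) (σ : L ≃ₐ[RatFunc ℂ] L)
    (hσ : σ x = x) : σ = 1 := by
  refine algEquiv_eq_one (f := f) hf fun y hy ↦ ?_
  obtain ⟨τ, rfl⟩ := exists_algEquiv_root hf hx hy
  have hcomm : σ * τ = τ * σ := hc.isMulCommutative.is_comm.comm σ τ
  rw [← AlgEquiv.mul_apply, hcomm, AlgEquiv.mul_apply, hσ]

/-- If the root field is Galois, the automorphisms act by affine maps, whence the group is cyclic
and `f` is equivalent to a power. -/
lemma isCyclic_and_cyclicPoly_of_regular (hf : 1 < f.natDegree) {x : L}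
    (hx : aeval x f = algebraMap (RatFunc ℂ) L RatFunc.X)
    (hreg : ∀ σ : L ≃ₐ[RatFunc ℂ] L, σ x = x → σ = 1) :
    IsCyclic (L ≃ₐ[RatFunc ℂ] L) ∧ CyclicPoly f := by
  have hf0 : f.natDegree ≠ 0 := by omega
  have htr := transcendental_root hx
  have hx0 : x ≠ 0 := by rintro rfl; exact htr isAlgebraic_zero
  have hcard := card_algEquiv_of_regular hf0 hx hreg
  have : Finite (L ≃ₐ[RatFunc ℂ] L) := Nat.finite_of_card_ne_zero (hcard.trans_ne hf0)
  have haff : ∀ σ : L ≃ₐ[RatFunc ℂ] L, ∃ a b : ℂ,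
      σ x = algebraMap ℂ L a * x + algebraMap ℂ L b := fun σ ↦
    exists_linear_of_fixed hf0 hx (fun τ hτ ↦ by rw [hreg τ hτ, AlgEquiv.one_apply])
      (isIntegral_root_adjoin_root hf0 hx (aeval_algEquiv_root σ hx))
      (isIntegral_div_of_aeval_eq hf0 hx0 ((aeval_algEquiv_root σ hx).trans hx.symm))
  choose a b hab using haff
  have huniq : ∀ c d c' d' : ℂ, algebraMap ℂ L c * x + algebraMap ℂ L d =
      algebraMap ℂ L c' * x + algebraMap ℂ L d' → c = c' := by
    intro c d c' d' h
    have : C c * X + C d = C c' * X + C d' :=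
      transcendental_iff_injective.1 htr (by simpa using h)
    simpa using congrArg (coeff · 1) this
  let φ : (L ≃ₐ[RatFunc ℂ] L) →* ℂ :=
    { toFun := a
      map_one' := huniq _ (b 1) _ 0 (by rw [← hab]; simp)
      map_mul' := fun σ τ ↦ huniq _ (b (σ * τ)) _ (a τ * b σ + b τ) (by
        rw [← hab, AlgEquiv.mul_apply, hab τ, map_add, map_mul, algEquiv_algebraMap,
          algEquiv_algebraMap, hab σ]
        simp only [map_add, map_mul]
        ring) }
  have hφ : Function.Injective φ := by
    refine (injective_iff_map_eq_one φ).2 fun σ hσ ↦ hreg σ ?_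
    have hσ1 : a σ = 1 := hσ
    have h := hab σ
    rw [hσ1, map_one, one_mul] at h
    rw [h, eq_zero_of_translation (hcard.trans_ne hf0) (pow_card_eq_one' (x := σ)) h
      (algEquiv_algebraMap σ _), add_zero]
  have hcyc : IsCyclic (L ≃ₐ[RatFunc ℂ] L) := isCyclic_of_injective_ringHom φ hφ
  refine ⟨hcyc, f.natDegree, hf, ?_⟩
  obtain ⟨g, hg⟩ := hcyc.exists_generator
  have hord : orderOf g = f.natDegree := by
    rw [orderOf_eq_card_of_forall_mem_zpowers hg, hcard]
  have hgn : a g ^ f.natDegree = 1 := by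
    have : φ (g ^ f.natDegree) = 1 := by rw [← hord, pow_orderOf_eq_one, map_one]
    rwa [map_pow] at this
  have hg1 : a g - 1 ≠ 0 := fun h ↦ by
    have : g = 1 := hφ (by rw [map_one]; exact sub_eq_zero.1 h)
    rw [this, orderOf_one] at hord
    omega
  set c := b g / (a g - 1) with hc
  have hcg : algebraMap ℂ L (b g) = algebraMap ℂ L (a g) * algebraMap ℂ L c -
      algebraMap ℂ L c := by
    rw [← map_mul, ← map_sub, hc]
    congr 1
    field_simp
  have hgu : g (x + algebraMap ℂ L c) = algebraMap ℂ L (a g) * (x + algebraMap ℂ L c) := by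
    rw [map_add, algEquiv_algebraMap, hab g, hcg]
    ring
  have hfix : g ((x + algebraMap ℂ L c) ^ f.natDegree) = (x + algebraMap ℂ L c) ^ f.natDegree := by
    rw [map_pow, hgu, mul_pow, ← map_pow, hgn, map_one, one_mul]
  have hlin : (X + C c).natDegree = 1 := natDegree_X_add_C c
  obtain ⟨l, hl, hfl⟩ := exists_linear_comp_eq (h := (X ^ f.natDegree).comp (X + C c)) hf0 hx
    (w := (x + algebraMap ℂ L c) ^ f.natDegree)
    (fun σ ↦ by
      have : Subgroup.zpowers g ≤ MulAction.stabilizer (L ≃ₐ[RatFunc ℂ] L)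
        ((x + algebraMap ℂ L c) ^ f.natDegree) := (Subgroup.zpowers_le).2 hfix
      exact this (hg σ))
    (((isIntegral_root hf0 hx).add (isIntegral_algebraMap (x := algebraMap ℂ _ c))).pow _)
    (by simp) (by rw [natDegree_comp, hlin, natDegree_X_pow, mul_one])
  exact ⟨l, X + C c, hl, hlin, hfl⟩

lemma regular_of_cyclicPoly (hf : f.natDegree ≠ 0) (hcyc : CyclicPoly f) {x : L}
    (hx : aeval x f = algebraMap (RatFunc ℂ) L RatFunc.X) (σ : L ≃ₐ[RatFunc ℂ] L)
    (hσ : σ x = x) : σ = 1 := by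
  obtain ⟨m, hm, l₁, l₂, hl₁, hl₂, hfl⟩ := hcyc
  obtain ⟨a₁, b₁, rfl⟩ := exists_eq_X_add_C_of_natDegree_le_one hl₁.le
  obtain ⟨a₂, b₂, rfl⟩ := exists_eq_X_add_C_of_natDegree_le_one hl₂.le
  have ha₁ : a₁ ≠ 0 := by rintro rfl; simp at hl₁
  have ha₂ : a₂ ≠ 0 := by rintro rfl; simp at hl₂
  have hev : ∀ y : L, aeval y f = algebraMap ℂ L a₁ * (algebraMap ℂ L a₂ * y +
      algebraMap ℂ L b₂) ^ m + algebraMap ℂ L b₁ := fun y ↦ by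
    rw [hfl]; simp
  refine algEquiv_eq_one (f := f) hf fun y hy ↦ ?_
  have hA₁ : algebraMap ℂ L a₁ ≠ 0 := by simpa using ha₁
  have hA₂ : algebraMap ℂ L a₂ ≠ 0 := by simpa using ha₂
  have hpow : (algebraMap ℂ L a₂ * y + algebraMap ℂ L b₂) ^ m =
      (algebraMap ℂ L a₂ * x + algebraMap ℂ L b₂) ^ m := by
    have := hy.trans hx.symm
    rw [hev, hev] at this
    exact mul_left_cancel₀ hA₁ (add_right_cancel this)
  have hx2 : algebraMap ℂ L a₂ * x + algebraMap ℂ L b₂ ≠ 0 := by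
    intro h
    refine transcendental_root hx ⟨C a₂ * X + C b₂, ?_, by simpa using h⟩
    intro h0
    simp [h0] at hl₂
  have : NeZero m := ⟨by omega⟩
  obtain ⟨i, -, hi⟩ := ((Complex.isPrimitiveRoot_exp m (by omega)).map_of_injective
    (algebraMap ℂ L).injective).eq_pow_of_pow_eq_one
    (ξ := (algebraMap ℂ L a₂ * y + algebraMap ℂ L b₂) / (algebraMap ℂ L a₂ * x +
      algebraMap ℂ L b₂)) (by rw [div_pow, hpow, div_self (pow_ne_zero _ hx2)])
  rw [eq_div_iff hx2, ← map_pow] at hi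
  have h := congrArg σ hi
  rw [map_mul, map_add, map_mul, map_add, map_mul] at h
  simp only [algEquiv_algebraMap, hσ] at h
  rw [hi] at h
  exact (mul_left_cancel₀ hA₂ (add_right_cancel h)).symm

omit [Algebra (RatFunc ℂ) L] [IsScalarTower ℂ (RatFunc ℂ) L]
  [IsSplittingField (RatFunc ℂ) L (monPoly f)] in
lemma aeval_chebT {y z : L} (h : y * z = 1) (n : ℕ) :
    aeval (y + z) (chebT n) = y ^ n + z ^ n := by
  rw [chebT, aeval_def, ← eval_map, map_dickson, map_one, dickson_one_one_eval_add_inv y z h]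

lemma natDegree_chebT (n : ℕ) : (chebT n).natDegree = n := by
  let := invertibleOfNonzero (two_ne_zero : (2 : ℂ) ≠ 0)
  rw [chebT, dickson_one_one_eq_chebyshev_T, ← C_ofNat, natDegree_C_mul two_ne_zero,
    natDegree_comp, Chebyshev.natDegree_T, natDegree_C_mul_X _ (by simp)]
  simp

/-- The elements `r`, `s` play the roles of a rotation and of the reflection fixing `x`. -/
lemma dihedralPoly_of_rotation_reflection (hf : 2 < f.natDegree) {x : L}
    (hx : aeval x f = algebraMap (RatFunc ℂ) L RatFunc.X) {r s : L ≃ₐ[RatFunc ℂ] L}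
    (hr : r ^ f.natDegree = 1) (hsx : s x = x) (hsr : s (r x) = r⁻¹ x) (hsr' : s (r⁻¹ x) = r x)
    (hstab : ∀ σ : L ≃ₐ[RatFunc ℂ] L, σ x = x → σ = 1 ∨ σ = s)
    (hgen : ∀ w : L, r w = w → s w = w → ∀ σ : L ≃ₐ[RatFunc ℂ] L, σ w = w)
    (hne : r x ≠ r⁻¹ x) : DihedralPoly f := by
  have hf0 : f.natDegree ≠ 0 := by omega
  have htr := transcendental_root hx
  have hx0 : x ≠ 0 := by rintro rfl; exact htr isAlgebraic_zero
  have hstab' : ∀ w : L, s w = w → ∀ σ : L ≃ₐ[RatFunc ℂ] L, σ x = x → σ w = w := by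
    intro w hw σ hσ
    rcases hstab σ hσ with rfl | rfl
    · rfl
    · exact hw
  have hrr : r (r⁻¹ x) = x := by rw [← AlgEquiv.mul_apply, mul_inv_cancel, AlgEquiv.one_apply]
  have hxint : ∀ σ : L ≃ₐ[RatFunc ℂ] L, IsIntegral (Algebra.adjoin ℂ {x}) (σ x) := fun σ ↦
    isIntegral_root_adjoin_root hf0 hx (aeval_algEquiv_root σ hx)
  have hdiv : ∀ σ : L ≃ₐ[RatFunc ℂ] L, IsIntegral (Algebra.adjoin ℂ {x⁻¹}) (σ x / x) := fun σ ↦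
    isIntegral_div_of_aeval_eq hf0 hx0 ((aeval_algEquiv_root σ hx).trans hx.symm)
  -- the orbit of `x` under `r` satisfies an affine recurrence of order two
  obtain ⟨a, b, hab⟩ := exists_linear_of_fixed (w := r x + r⁻¹ x) hf0 hx
    (hstab' _ (by rw [map_add, hsr, hsr', add_comm])) ((hxint r).add (hxint r⁻¹))
    (by rw [add_div]; exact (hdiv r).add (hdiv r⁻¹))
  have hrrx : r (r x) = algebraMap ℂ L a * r x + algebraMap ℂ L b - x := by
    have := congrArg r hab
    rw [map_add, hrr, map_add, map_mul, algEquiv_algebraMap, algEquiv_algebraMap] at this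
    exact eq_sub_of_add_eq this
  obtain ⟨l, hl⟩ := IsAlgClosed.exists_root (X ^ 2 - C a * X + 1 : ℂ[X]) (by
    have : (X ^ 2 - C a * X + 1 : ℂ[X]).degree = 2 := by compute_degree!
    rw [this]; decide)
  simp only [IsRoot, eval_add, eval_sub, eval_pow, eval_X, eval_mul, eval_C, eval_one] at hl
  obtain ⟨l', hal⟩ : ∃ l', a = l + l' := ⟨a - l, by ring⟩
  subst hal
  have hll : l * l' = 1 := by linear_combination -hl
  have hLL : algebraMap ℂ L l * algebraMap ℂ L l' = 1 := by rw [← map_mul, hll, map_one]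
  rw [map_add] at hrrx hab
  have hnfix : ∀ c d : ℂ, r x ≠ algebraMap ℂ L c * x + algebraMap ℂ L d := by
    intro c d h
    apply hne
    have := congrArg s h
    rw [hsr, map_add, map_mul, algEquiv_algebraMap, algEquiv_algebraMap, hsx, ← h] at this
    exact this.symm
  have hl1 : l ≠ 1 := by
    rintro rfl
    obtain rfl : l' = 1 := by simpa using hll
    rw [map_one] at hrrx
    have hb := eq_zero_of_translation hf0 hr (v := r x - x) (c := algebraMap ℂ L b)
      (by rw [map_sub, hrrx]; ring) (algEquiv_algebraMap r b)
    have hu := eq_zero_of_translation hf0 hr (v := x) (c := r x - x) (by ring)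
      (by rw [map_sub, hrrx, hb]; ring)
    exact hnfix 1 0 (by rw [map_one, map_zero]; linear_combination hu)
  have hl2 : l ≠ -1 := by
    rintro rfl
    obtain rfl : l' = -1 := by linear_combination -hll
    rw [map_neg, map_one] at hrrx
    have hb2 : algebraMap ℂ L b = 2 * algebraMap ℂ L (b / 2) := by
      rw [← map_ofNat (algebraMap ℂ L) 2, ← map_mul]; congr 1; ring
    have hu := eq_zero_of_translation (σ := r ^ 2) hf0 (by rw [pow_right_comm, hr, one_pow])
      (v := x) (c := -2 * (r x + x - algebraMap ℂ L (b / 2)))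
      (by rw [pow_two, AlgEquiv.mul_apply, hrrx, hb2]; ring)
      (by
        simp only [pow_two, AlgEquiv.mul_apply, hrrx, map_mul, map_neg, map_ofNat, map_sub,
          map_add, algEquiv_algebraMap, hb2, map_one]
        ring)
    have : CharZero L := charZero_of_injective_algebraMap (algebraMap ℂ L).injective
    have hu' := (mul_eq_zero.1 hu).resolve_left (by norm_num)
    exact hnfix (-1) (b / 2) (by rw [map_neg, map_one]; linear_combination hu')
  have hlne : l - l' ≠ 0 := by
    intro h
    have : (l - 1) * (l + 1) = 0 := by linear_combination hll + l * h
    rcases mul_eq_zero.1 this with h | h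
    · exact hl1 (sub_eq_zero.1 h)
    · exact hl2 (eq_neg_of_add_eq_zero_left h)
  have hl1' := sub_ne_zero.2 hl1
  obtain ⟨d, hd⟩ : ∃ d : ℂ, b = d * (l - 1) := ⟨b / (l - 1), by field_simp⟩
  subst hd
  rw [map_mul, map_sub, map_one] at hrrx hab
  -- eigenvectors of the rotation
  set y := r x - algebraMap ℂ L l' * x + algebraMap ℂ L d with hy
  set z := r⁻¹ x - algebraMap ℂ L l' * x + algebraMap ℂ L d with hz
  have hry : r y = algebraMap ℂ L l * y := by
    rw [hy, map_add, map_sub, map_mul, algEquiv_algebraMap, algEquiv_algebraMap, hrrx]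
    linear_combination x * hLL
  have hrz : r z = algebraMap ℂ L l' * z := by
    rw [hz, map_add, map_sub, map_mul, algEquiv_algebraMap, algEquiv_algebraMap, hrr]
    linear_combination (-algebraMap ℂ L l') * hab - (x + algebraMap ℂ L d) * hLL
  have hsy : s y = z := by
    rw [hy, map_add, map_sub, map_mul, algEquiv_algebraMap, algEquiv_algebraMap, hsx, hsr]
  have hsz : s z = y := by
    rw [hz, map_add, map_sub, map_mul, algEquiv_algebraMap, algEquiv_algebraMap, hsx, hsr']
  have hy0 : y ≠ 0 := fun h ↦
    hnfix l' (-d) (by rw [map_neg]; linear_combination hy.symm.trans h)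
  have hz0 : z ≠ 0 := fun h ↦ hy0 (by rw [← hsz, h, map_zero])
  have hintt : ∀ σ : L ≃ₐ[RatFunc ℂ] L,
      IsIntegral (Algebra.adjoin ℂ {algebraMap (RatFunc ℂ) L RatFunc.X})
        (σ x - algebraMap ℂ L l' * x + algebraMap ℂ L d) := fun σ ↦
    (((isIntegral_root hf0 (aeval_algEquiv_root σ hx)).sub
      ((isIntegral_algebraMap (x := algebraMap ℂ _ l')).mul (isIntegral_root hf0 hx))).add
      (isIntegral_algebraMap (x := algebraMap ℂ _ d)))
  have hdiv2 : ∀ σ : L ≃ₐ[RatFunc ℂ] L, IsIntegral (Algebra.adjoin ℂ {x⁻¹})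
      ((σ x - algebraMap ℂ L l' * x + algebraMap ℂ L d) / x) := by
    intro σ
    have : (σ x - algebraMap ℂ L l' * x + algebraMap ℂ L d) / x =
      σ x / x - algebraMap ℂ L l' + algebraMap ℂ L d * x⁻¹ := by field_simp
    rw [this]
    exact ((hdiv σ).sub (isIntegral_algebraMap (x := algebraMap ℂ _ l'))).add
      ((isIntegral_algebraMap (x := algebraMap ℂ _ d)).mul
      (isIntegral_algebraMap (x := (⟨_, Algebra.self_mem_adjoin_singleton ℂ _⟩ :
        Algebra.adjoin ℂ {x⁻¹}))))
  have hyzfix : ∀ σ : L ≃ₐ[RatFunc ℂ] L, σ (y * z) = y * z :=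
    hgen _ (by rw [map_mul, hry, hrz]; linear_combination (y * z) * hLL)
      (by rw [map_mul, hsy, hsz, mul_comm])
  obtain ⟨P, hP⟩ := exists_aeval_eq_of_isIntegral (transcendental_algebraMap_X L)
    (mem_adjoin_of_fixed hf0 hyzfix) ((hintt r).mul (hintt r⁻¹))
  have hPdeg : (P.comp f).natDegree ≤ 2 := by
    refine natDegree_le_of_isIntegral_div_pow htr ?_
    rw [aeval_comp, hx, hP, pow_two, mul_div_mul_comm]
    exact (hdiv2 r).mul (hdiv2 r⁻¹)
  rw [natDegree_comp] at hPdeg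
  have hP0 : P.natDegree = 0 := by
    by_contra h
    have := Nat.le_mul_of_pos_left f.natDegree (Nat.pos_of_ne_zero h)
    omega
  rw [eq_C_of_natDegree_eq_zero hP0, aeval_C] at hP
  obtain ⟨k, hk⟩ := IsAlgClosed.exists_pow_nat_eq (P.coeff 0) (n := 2) (by norm_num)
  have hk0 : k ≠ 0 := by
    rintro rfl
    rw [← hk, zero_pow two_ne_zero, map_zero] at hP
    exact mul_ne_zero hy0 hz0 hP.symm
  have hK0 : algebraMap ℂ L k ≠ 0 := by simpa using hk0
  rw [← hk, map_pow] at hP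
  set κ := algebraMap ℂ L k⁻¹ with hκ
  have hκk : κ * algebraMap ℂ L k = 1 := by rw [hκ, ← map_mul, inv_mul_cancel₀ hk0, map_one]
  have hYZ : (κ * y) * (κ * z) = 1 := by
    linear_combination (-κ ^ 2) * hP + (κ * algebraMap ℂ L k + 1) * hκk
  have hln : algebraMap ℂ L l ^ f.natDegree = 1 := by
    have : ∀ j : ℕ, (r ^ j) y = algebraMap ℂ L l ^ j * y := by
      intro j
      induction j with
      | zero => simp
      | succ j ih =>
        rw [pow_succ', AlgEquiv.mul_apply, ih, map_mul, map_pow, algEquiv_algebraMap, hry]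
        ring
    have h := this f.natDegree
    rw [hr, AlgEquiv.one_apply] at h
    exact mul_right_cancel₀ hy0 (by rw [← h, one_mul])
  have hln' : algebraMap ℂ L l' ^ f.natDegree = 1 := by
    have := congrArg (· ^ f.natDegree) hLL
    simpa [mul_pow, hln] using this
  set q : ℂ[X] := C (k⁻¹ * (l - l')) * X + C (k⁻¹ * (d * (l + 1))) with hq
  have hq1 : q.natDegree = 1 := natDegree_linear (mul_ne_zero (inv_ne_zero hk0) hlne)
  have hqx : aeval x q = κ * y + κ * z := by
    simp only [hq, map_add, map_mul, aeval_C, aeval_X, hy, hz, map_sub, map_one, ← hκ]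
    linear_combination (-κ) * hab
  obtain ⟨p, hp, hfp⟩ := exists_linear_comp_eq (h := (chebT f.natDegree).comp q) hf0 hx
    (w := (κ * y) ^ f.natDegree + (κ * z) ^ f.natDegree)
    (hgen _
      (by simp only [map_add, map_pow, map_mul, hry, hrz, hκ, algEquiv_algebraMap, mul_pow,
            hln, hln', one_mul])
      (by simp only [map_add, map_pow, map_mul, hsy, hsz, hκ, algEquiv_algebraMap, add_comm]))
    ((((isIntegral_algebraMap (x := algebraMap ℂ _ k⁻¹)).mul (hintt r)).pow _).add
      (((isIntegral_algebraMap (x := algebraMap ℂ _ k⁻¹)).mul (hintt r⁻¹)).pow _))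
    (by rw [aeval_comp, hqx, aeval_chebT hYZ])
    (by rw [natDegree_comp, natDegree_chebT, hq1, mul_one])
  exact ⟨f.natDegree, hf, p, q, hp, hq1, hfp⟩

lemma dihedralPoly_of_mulEquiv (hf : 2 < f.natDegree) {m : ℕ}
    (e : (L ≃ₐ[RatFunc ℂ] L) ≃* DihedralGroup m) : DihedralPoly f := by
  have hf0 : f.natDegree ≠ 0 := by omega
  obtain ⟨x, hx⟩ := exists_root_monPoly (L := L) hf0
  have hmul : ∀ (d d' : DihedralGroup m) (u : L),
      e.symm (d * d') u = e.symm d (e.symm d' u) := fun d d' u ↦ by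
    rw [map_mul, AlgEquiv.mul_apply]
  have hfree : ∀ i : ZMod m, e.symm (.r i) x = x → i = 0 := by
    intro i hi
    have hi' : e.symm (.r (-i)) x = x := by
      conv_lhs => rw [← hi]
      rw [← hmul, DihedralGroup.r_mul_r, neg_add_cancel, DihedralGroup.r_zero, map_one,
        AlgEquiv.one_apply]
    have h1 : e.symm (.r i) = 1 := by
      refine algEquiv_eq_one (f := f) hf0 fun y hy ↦ ?_
      obtain ⟨τ, rfl⟩ := exists_algEquiv_root hf0 hx hy
      obtain ⟨t, rfl⟩ := e.symm.surjective τ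
      rw [← hmul]
      rcases t with j | j
      · rw [DihedralGroup.r_mul_r, add_comm, ← DihedralGroup.r_mul_r, hmul, hi]
      · rw [DihedralGroup.r_mul_sr, sub_eq_add_neg, ← DihedralGroup.sr_mul_r, hmul, hi']
    rw [← map_one e.symm, DihedralGroup.one_def] at h1
    exact DihedralGroup.r.inj (e.symm.injective h1)
  obtain ⟨j, hj⟩ : ∃ j : ZMod m, e.symm (.sr j) x = x := by
    by_contra! hcon
    have hreg : ∀ σ : L ≃ₐ[RatFunc ℂ] L, σ x = x → σ = 1 := by
      intro σ hσ
      obtain ⟨t, rfl⟩ := e.symm.surjective σ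
      rcases t with i | i
      · rw [hfree i hσ, DihedralGroup.r_zero, map_one]
      · exact absurd hσ (hcon i)
    have hcyc := (isCyclic_and_cyclicPoly_of_regular (by omega) hx hreg).1
    have hm : m = 1 := DihedralGroup.isCyclic_iff.1 (e.isCyclic.1 hcyc)
    have hcard := card_algEquiv_of_regular hf0 hx hreg
    rw [Nat.card_congr e.toEquiv, DihedralGroup.nat_card, hm] at hcard
    omega
  have hm : m = f.natDegree := by
    rw [← ncard_rootSet_monPoly (L := L) hf0, ← Nat.card_coe_set_eq, ← Nat.card_zmod m]
    refine Nat.card_eq_of_bijective (fun i : ZMod m ↦ (⟨e.symm (.r i) x, (mem_rootSet_monPoly hf0).2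
      (aeval_algEquiv_root _ hx)⟩ : (monPoly f).rootSet L)) ⟨fun i i' h ↦ ?_, fun y ↦ ?_⟩
    · have h' : e.symm (.r i) x = e.symm (.r i') x := congrArg Subtype.val h
      refine (neg_add_eq_zero.1 (hfree (-i + i') ?_))
      rw [← DihedralGroup.r_mul_r, hmul, ← h', ← hmul, DihedralGroup.r_mul_r, neg_add_cancel,
        DihedralGroup.r_zero, map_one, AlgEquiv.one_apply]
    · obtain ⟨τ, hτ⟩ := exists_algEquiv_root hf0 hx ((mem_rootSet_monPoly hf0).1 y.2)
      obtain ⟨t, rfl⟩ := e.symm.surjective τ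
      rcases t with i | i
      · exact ⟨i, Subtype.ext hτ⟩
      · refine ⟨j - i, Subtype.ext ?_⟩
        rw [← hτ]
        change e.symm (.r (j - i)) x = _
        conv_lhs => rw [← hj]
        rw [← hmul, DihedralGroup.r_mul_sr, sub_sub_cancel]
  have hinv : (e.symm (.r 1))⁻¹ = e.symm (.r (-1)) := by
    rw [← map_inv, DihedralGroup.inv_r]
  refine dihedralPoly_of_rotation_reflection hf hx (r := e.symm (.r 1)) (s := e.symm (.sr j))
    ?_ hj ?_ ?_ ?_ ?_ ?_
  · rw [← map_pow, ← hm, DihedralGroup.r_one_pow_n, map_one]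
  · rw [hinv, ← hmul, DihedralGroup.sr_mul_r]
    conv_rhs => rw [← hj]
    rw [← hmul, DihedralGroup.r_mul_sr, sub_neg_eq_add]
  · rw [hinv, ← hmul, DihedralGroup.sr_mul_r]
    conv_rhs => rw [← hj]
    rw [← hmul, DihedralGroup.r_mul_sr, sub_eq_add_neg]
  · intro σ hσ
    obtain ⟨t, rfl⟩ := e.symm.surjective σ
    rcases t with i | i
    · left
      rw [hfree i hσ, DihedralGroup.r_zero, map_one]
    · right
      have : j - i = 0 := hfree _ (by
        rw [← DihedralGroup.sr_mul_sr, hmul, hj, hσ])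
      rw [sub_eq_zero.1 this]
  · intro w hrw hsw σ
    obtain ⟨t, rfl⟩ := e.symm.surjective σ
    have hrot : ∀ i : ZMod m, e.symm (.r i) w = w := by
      intro i
      obtain ⟨k, rfl⟩ := ZMod.intCast_surjective i
      have : e.symm (.r 1) ∈ MulAction.stabilizer (L ≃ₐ[RatFunc ℂ] L) w := hrw
      rw [← DihedralGroup.r_one_zpow, map_zpow]
      exact zpow_mem this k
    rcases t with i | i
    · exact hrot i
    · rw [← add_sub_cancel j i, ← DihedralGroup.sr_mul_r, hmul, hrot, hsw]
  · intro h
    rw [hinv] at h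
    have h2 : ((2 : ℕ) : ZMod m) = 0 := hfree _ (by
      have : ((2 : ℕ) : ZMod m) = 1 + 1 := by norm_num
      rw [this, ← DihedralGroup.r_mul_r, hmul, h, ← hmul, DihedralGroup.r_mul_r, add_neg_cancel,
        DihedralGroup.r_zero, map_one, AlgEquiv.one_apply])
    have := Nat.le_of_dvd (by norm_num) ((ZMod.natCast_eq_zero_iff _ _).1 h2)
    omega

/-- Elements `R`, `S` of a group satisfying the dihedral relations define a homomorphism. -/
lemma exists_dihedralGroup_hom {G : Type*} [Group G] {n : ℕ} {R S : G} (hR : R ^ n = 1)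
    (hS : S * S = 1) (hSR : S * R * S = R⁻¹) :
    ∃ φ : DihedralGroup n →* G, ∀ k : ℤ,
      φ (.r (k : ZMod n)) = R ^ k ∧ φ (.sr (k : ZMod n)) = S * R ^ k := by
  have hSinv : S⁻¹ = S := inv_eq_of_mul_eq_one_right hS
  have hconj : ∀ k : ℤ, R ^ k * S = S * R ^ (-k) := by
    intro k
    have h : S * R ^ k * S⁻¹ = R ^ (-k) := by
      rw [← conj_zpow, hSinv, hSR, inv_zpow, zpow_neg]
    rw [← h, hSinv, ← mul_assoc, ← mul_assoc, hS, one_mul]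
  let ρ : ZMod n →+ Additive G := ZMod.lift n ⟨zmultiplesHom (Additive G) (Additive.ofMul R), by
    rw [zmultiplesHom_apply, natCast_zsmul, ← ofMul_pow, hR, ofMul_one]⟩
  have hρ : ∀ k : ℤ, (ρ (k : ZMod n)).toMul = R ^ k := by
    intro k
    simp [ρ]
  let F : DihedralGroup n → G
    | .r i => (ρ i).toMul
    | .sr i => S * (ρ i).toMul
  have hFr : ∀ k : ℤ, F (.r (k : ZMod n)) = R ^ k := hρ
  have hFsr : ∀ k : ℤ, F (.sr (k : ZMod n)) = S * R ^ k := fun k ↦ congrArg (S * ·) (hρ k)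
  refine ⟨MonoidHom.mk' F ?_, fun k ↦ ⟨hFr k, hFsr k⟩⟩
  rintro (i | i) (j | j) <;> obtain ⟨i, rfl⟩ := ZMod.intCast_surjective i <;>
    obtain ⟨j, rfl⟩ := ZMod.intCast_surjective j
  · rw [DihedralGroup.r_mul_r, ← Int.cast_add, hFr, hFr, hFr, zpow_add]
  · rw [DihedralGroup.r_mul_sr, ← Int.cast_sub, hFr, hFsr, hFsr, ← mul_assoc, hconj, mul_assoc,
      ← zpow_add, sub_eq_neg_add]
  · rw [DihedralGroup.sr_mul_r, ← Int.cast_add, hFr, hFsr, hFsr, mul_assoc, zpow_add]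
  · rw [DihedralGroup.sr_mul_sr, ← Int.cast_sub, hFr, hFsr, hFsr, mul_assoc, ← mul_assoc _ S,
      hconj, mul_assoc, ← zpow_add, ← mul_assoc, hS, one_mul, sub_eq_neg_add]

lemma IsPrimitiveRoot.eq_pow_mul_or_of_pow_add_inv_pow_eq {K : Type*} [Field K] {n : ℕ} [NeZero n]
    {ζ v y : K} (hζ : IsPrimitiveRoot ζ n) (hv : v ≠ 0) (hy : y ≠ 0)
    (h : v ^ n + v⁻¹ ^ n = y ^ n + y⁻¹ ^ n) : ∃ i : ℕ, v = ζ ^ i * y ∨ v = ζ ^ i * y⁻¹ := by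
  have hv' : v ^ n * v⁻¹ ^ n = 1 := by rw [← mul_pow, mul_inv_cancel₀ hv, one_pow]
  have hy' : y ^ n * y⁻¹ ^ n = 1 := by rw [← mul_pow, mul_inv_cancel₀ hy, one_pow]
  have hprod : (v ^ n - y ^ n) * (v ^ n - y⁻¹ ^ n) = 0 := by
    linear_combination v ^ n * h - hv' + hy'
  have key : ∀ u : K, u ≠ 0 → v ^ n = u ^ n → ∃ i : ℕ, v = ζ ^ i * u := by
    intro u hu hvu
    obtain ⟨i, -, hi⟩ := hζ.eq_pow_of_pow_eq_one (ξ := v / u)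
      (by rw [div_pow, hvu, div_self (pow_ne_zero _ hu)])
    exact ⟨i, by rw [hi, div_mul_cancel₀ _ hu]⟩
  rcases mul_eq_zero.1 hprod with h | h
  · obtain ⟨i, hi⟩ := key y hy (sub_eq_zero.1 h)
    exact ⟨i, .inl hi⟩
  · obtain ⟨i, hi⟩ := key y⁻¹ (inv_ne_zero hy) (sub_eq_zero.1 h)
    exact ⟨i, .inr hi⟩

omit [IsSplittingField (RatFunc ℂ) L (monPoly f)] in
/-- The group acts on `y` as the dihedral group generated by `y ↦ ζ y` and `y ↦ y⁻¹`. -/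
lemma nonempty_mulEquiv_dihedralGroup {n : ℕ} {ζ : ℂ} (hζ : IsPrimitiveRoot ζ n) {y : L}
    (hy : Transcendental ℂ y) (hfaith : ∀ σ : L ≃ₐ[RatFunc ℂ] L, σ y = y → σ = 1)
    (hval : ∀ σ : L ≃ₐ[RatFunc ℂ] L, ∃ i : ℕ,
      σ y = algebraMap ℂ L ζ ^ i * y ∨ σ y = algebraMap ℂ L ζ ^ i * y⁻¹)
    {R S : L ≃ₐ[RatFunc ℂ] L} (hR : R y = algebraMap ℂ L ζ * y) (hS : S y = y⁻¹) (hn : n ≠ 0) :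
    Nonempty ((L ≃ₐ[RatFunc ℂ] L) ≃* DihedralGroup n) := by
  have hy0 : y ≠ 0 := by rintro rfl; exact hy isAlgebraic_zero
  have hζ0 : ζ ≠ 0 := hζ.ne_zero hn
  set z := algebraMap ℂ L ζ with hz
  have hz0 : z ≠ 0 := by simpa [hz] using hζ0
  have hzn : z ^ n = 1 := by rw [hz, ← map_pow, hζ.pow_eq_one, map_one]
  have hzfix : ∀ σ : L ≃ₐ[RatFunc ℂ] L, σ z = z := fun σ ↦ algEquiv_algebraMap σ ζ
  have hext : ∀ σ τ : L ≃ₐ[RatFunc ℂ] L, σ y = τ y → σ = τ := by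
    intro σ τ h
    refine (inv_mul_eq_one.1 (hfaith _ ?_)).symm
    rw [AlgEquiv.mul_apply, h, ← AlgEquiv.mul_apply, inv_mul_cancel, AlgEquiv.one_apply]
  have hRpow : ∀ k : ℕ, (R ^ k) y = z ^ k * y := by
    intro k
    induction k with
    | zero => simp
    | succ k ih => rw [pow_succ', AlgEquiv.mul_apply, ih, map_mul, map_pow, hzfix, hR]; ring
  have hRn : R ^ n = 1 := hext _ _ (by rw [hRpow, hzn, one_mul, AlgEquiv.one_apply])
  have hSS : S * S = 1 := hext _ _ (by
    rw [AlgEquiv.mul_apply, hS, map_inv₀, hS, inv_inv, AlgEquiv.one_apply])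
  have hSR : S * R * S = R⁻¹ := by
    refine (inv_eq_of_mul_eq_one_right (hext _ _ ?_)).symm
    simp only [AlgEquiv.mul_apply, hS, hR, map_inv₀, map_mul, hzfix, AlgEquiv.one_apply]
    field_simp
  obtain ⟨φ, hφ⟩ := exists_dihedralGroup_hom hRn hSS hSR
  have hφr : ∀ k : ℕ, φ (.r (k : ZMod n)) y = z ^ k * y := fun k ↦ by
    have := (hφ k).1
    rw [Int.cast_natCast, zpow_natCast] at this
    rw [this, hRpow]
  have hφsr : ∀ k : ℕ, φ (.sr (k : ZMod n)) y = z ^ k * y⁻¹ := fun k ↦ by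
    have := (hφ k).2
    rw [Int.cast_natCast, zpow_natCast] at this
    rw [this, AlgEquiv.mul_apply, hRpow, map_mul, map_pow, hzfix, hS]
  have : NeZero n := ⟨hn⟩
  refine ⟨(MulEquiv.ofBijective φ ⟨(injective_iff_map_eq_one φ).2 ?_, fun σ ↦ ?_⟩).symm⟩
  · rintro (i | i) h <;> obtain ⟨k, rfl⟩ := ZMod.natCast_zmod_surjective i
    · have h1 := hφr k
      rw [h, AlgEquiv.one_apply] at h1
      have h2 : z ^ k = 1 := mul_right_cancel₀ hy0 (by rw [← h1, one_mul])
      rw [hz, ← map_pow, ← map_one (algebraMap ℂ L)] at h2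
      have h3 := (hζ.pow_eq_one_iff_dvd k).1 ((algebraMap ℂ L).injective h2)
      rw [(ZMod.natCast_eq_zero_iff k n).2 h3, DihedralGroup.one_def]
    · have h1 := hφsr k
      rw [h, AlgEquiv.one_apply] at h1
      refine absurd ?_ (hy.pow (n := 2) two_pos)
      have : y ^ 2 = algebraMap ℂ L (ζ ^ k) := by
        rw [map_pow, ← hz, pow_two]
        nth_rewrite 1 [h1]
        rw [mul_assoc, inv_mul_cancel₀ hy0, mul_one]
      rw [this]
      exact isAlgebraic_algebraMap _
  · obtain ⟨i, hi | hi⟩ := hval σ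
    · exact ⟨.r i, hext _ _ (by rw [hφr, hi])⟩
    · exact ⟨.sr i, hext _ _ (by rw [hφsr, hi])⟩

lemma exists_add_inv_eq (hf : 2 < f.natDegree) {l₁ l₂ : ℂ[X]} (h₂ : l₂.natDegree = 1)
    (hl : f = l₁.comp ((chebT f.natDegree).comp l₂)) {x : L}
    (hx : aeval x f = algebraMap (RatFunc ℂ) L RatFunc.X) :
    ∃ y : L, y ≠ 0 ∧ aeval x l₂ = y + y⁻¹ := by
  have hf0 : f.natDegree ≠ 0 := by omega
  set n := f.natDegree with hn
  let M := AlgebraicClosure L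
  let ι := algebraMap L M
  set ζ : ℂ := Complex.exp (2 * Real.pi * Complex.I / n) with hζd
  have hζ : IsPrimitiveRoot ζ n := Complex.isPrimitiveRoot_exp n hf0
  have hζ0 : ζ ≠ 0 := hζ.ne_zero hf0
  obtain ⟨a, b, rfl⟩ := exists_eq_X_add_C_of_natDegree_le_one h₂.le
  have ha : a ≠ 0 := by rintro rfl; simp at h₂
  have hζsq : ζ - ζ⁻¹ ≠ 0 := by
    intro h
    have h1 : ζ ^ 2 = 1 := by
      field_simp at h
      linear_combination h
    have := Nat.le_of_dvd two_pos ((hζ.pow_eq_one_iff_dvd 2).1 h1)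
    omega
  set w := aeval x (C a * X + C b) with hw
  obtain ⟨u, hu⟩ := IsAlgClosed.exists_root (X ^ 2 - C (ι w) * X + 1 : M[X]) (by
    have : (X ^ 2 - C (ι w) * X + 1 : M[X]).degree = 2 := by compute_degree!
    rw [this]; decide)
  simp only [IsRoot, eval_add, eval_sub, eval_pow, eval_X, eval_mul, eval_C, eval_one] at hu
  have hu0 : u ≠ 0 := by rintro rfl; simp at hu
  have huw : ι w = u + u⁻¹ := by
    have h1 := mul_inv_cancel₀ hu0
    linear_combination (-u⁻¹) * hu + (u - ι w) * h1
  set z : M := algebraMap ℂ M ζ with hz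
  have hz0 : z ≠ 0 := by simpa [hz] using hζ0
  have hzn : z ^ n = 1 := by rw [hz, ← map_pow, hζ.pow_eq_one, map_one]
  set v : M := algebraMap ℂ M a⁻¹ * (z * u + (z * u)⁻¹ - algebraMap ℂ M b) with hv
  have hA : algebraMap ℂ M a * algebraMap ℂ M a⁻¹ = 1 := by
    rw [← map_mul, mul_inv_cancel₀ ha, map_one]
  have hvl : aeval v (C a * X + C b) = z * u + (z * u)⁻¹ := by
    simp only [map_add, map_mul, aeval_C, aeval_X, hv]
    linear_combination (z * u + (z * u)⁻¹ - algebraMap ℂ M b) * hA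
  have hxM : aeval (ι x) (C a * X + C b) = u + u⁻¹ := by
    rw [← huw, hw]
    exact aeval_algebraMap_apply M x _
  have hvf : aeval v f = algebraMap (RatFunc ℂ) M RatFunc.X := by
    have h1 : aeval v f = aeval (ι x) f := by
      rw [hl, aeval_comp, aeval_comp, hvl, aeval_chebT (mul_inv_cancel₀ (mul_ne_zero hz0 hu0)),
        aeval_comp, aeval_comp, hxM, aeval_chebT (mul_inv_cancel₀ hu0), inv_pow, inv_pow, mul_pow,
        hzn, one_mul]
    rw [h1, IsScalarTower.algebraMap_apply (RatFunc ℂ) L M, ← hx]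
    exact aeval_algebraMap_apply M x f
  have hvroot : (((monPoly f).map (algebraMap (RatFunc ℂ) L)).map ι).IsRoot v := by
    rw [Polynomial.map_map, ← IsScalarTower.algebraMap_eq, IsRoot, eval_map_algebraMap,
      aeval_monPoly, hvf, sub_self]
  obtain ⟨v', hv'⟩ := (IsSplittingField.splits L (monPoly f)).mem_range_of_isRoot
    (map_ne_zero (monPoly_ne_zero hf0)) hvroot
  have hmem : u ∈ ι.range := by
    have hu' : u = algebraMap ℂ M (ζ - ζ⁻¹)⁻¹ * (aeval v (C a * X + C b) -
        algebraMap ℂ M ζ⁻¹ * ι w) := by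
      have hd : algebraMap ℂ M (ζ - ζ⁻¹)⁻¹ * (z - z⁻¹) = 1 := by
        rw [hz, ← map_inv₀, ← map_sub, ← map_mul, inv_mul_cancel₀ hζsq, map_one]
      rw [hvl, huw, map_inv₀ _ ζ, ← hz, mul_inv]
      linear_combination (-u) * hd
    have hc : ∀ c : ℂ, algebraMap ℂ M c ∈ ι.range := fun c ↦
      ⟨algebraMap ℂ L c, (IsScalarTower.algebraMap_apply ℂ L M c).symm⟩
    rw [hu', ← hv']
    refine mul_mem (hc _) (sub_mem ?_ (mul_mem (hc _) ⟨w, rfl⟩))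
    exact ⟨aeval v' (C a * X + C b), (aeval_algebraMap_apply M v' _).symm⟩
  obtain ⟨y, rfl⟩ := hmem
  exact ⟨y, fun h ↦ hu0 (by rw [h, map_zero]), ι.injective (by rw [huw, map_add, map_inv₀])⟩

lemma nonempty_mulEquiv_of_dihedralPoly (hf : 2 < f.natDegree) (hdih : DihedralPoly f) :
    Nonempty ((L ≃ₐ[RatFunc ℂ] L) ≃* DihedralGroup f.natDegree) := by
  obtain ⟨m, -, l₁, l₂, h₁, h₂, hl⟩ := hdih
  obtain rfl : m = f.natDegree := by
    rw [hl, natDegree_comp, natDegree_comp, h₁, h₂, natDegree_chebT, one_mul, mul_one]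
  have hf0 : f.natDegree ≠ 0 := by omega
  have : NeZero f.natDegree := ⟨hf0⟩
  obtain ⟨x, hx⟩ := exists_root_monPoly (L := L) hf0
  have htr := transcendental_root hx
  obtain ⟨y, hy0, hxy⟩ := exists_add_inv_eq hf h₂ hl hx
  have hw : Transcendental ℂ (aeval x l₂) :=
    htr.aeval l₂ (by rw [h₂]; exact one_ne_zero) (mem_nonZeroDivisors_of_ne_zero
      (leadingCoeff_ne_zero.2 (by rintro rfl; simp at h₂)))
  have hytr : Transcendental ℂ y := fun h ↦ hw (hxy ▸ h.add h.inv)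
  obtain ⟨a, b, rfl⟩ := exists_eq_X_add_C_of_natDegree_le_one h₂.le
  have ha : a ≠ 0 := by rintro rfl; simp at h₂
  have hA : algebraMap ℂ L a ≠ 0 := by simpa using ha
  have hinj : ∀ {z z' : L}, aeval z (C a * X + C b) = aeval z' (C a * X + C b) → z = z' := by
    intro z z' h
    simpa [hA] using h
  set ζ : ℂ := Complex.exp (2 * Real.pi * Complex.I / f.natDegree)
  have hζ : IsPrimitiveRoot ζ f.natDegree := Complex.isPrimitiveRoot_exp _ hf0
  have hζL : IsPrimitiveRoot (algebraMap ℂ L ζ) f.natDegree :=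
    hζ.map_of_injective (algebraMap ℂ L).injective
  have hcheb : ∀ {z z' v v' : L}, v ≠ 0 → v' ≠ 0 → aeval z (C a * X + C b) = v + v⁻¹ →
      aeval z' (C a * X + C b) = v' + v'⁻¹ →
      (aeval z f = aeval z' f ↔ v ^ f.natDegree + v⁻¹ ^ f.natDegree =
        v' ^ f.natDegree + v'⁻¹ ^ f.natDegree) := by
    intro z z' v v' hv hv' hz hz'
    obtain ⟨c, d, rfl⟩ := exists_eq_X_add_C_of_natDegree_le_one h₁.le
    have hc : c ≠ 0 := by rintro rfl; simp at h₁
    have hcomp : ∀ {z v : L}, v ≠ 0 → aeval z (C a * X + C b) = v + v⁻¹ → aeval z f =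
        algebraMap ℂ L c * (v ^ f.natDegree + v⁻¹ ^ f.natDegree) + algebraMap ℂ L d := by
      intro z v hv hz
      conv_lhs => rw [hl]
      rw [aeval_comp, aeval_comp, hz, aeval_chebT (mul_inv_cancel₀ hv)]
      simp
    rw [hcomp hv hz, hcomp hv' hz', add_left_inj, mul_right_inj' (by simpa using hc)]
  have hroots : ∀ {z v : L}, aeval z f = algebraMap (RatFunc ℂ) L RatFunc.X → v ≠ 0 →
      aeval z (C a * X + C b) = v + v⁻¹ →
      ∃ i : ℕ, v = algebraMap ℂ L ζ ^ i * y ∨ v = algebraMap ℂ L ζ ^ i * y⁻¹ :=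
    fun hz hv hzv ↦ hζL.eq_pow_mul_or_of_pow_add_inv_pow_eq hv hy0
      ((hcheb hv hy0 hzv hxy).1 (hz.trans hx.symm))
  have hσ : ∀ (σ : L ≃ₐ[RatFunc ℂ] L) {z v : L}, aeval z (C a * X + C b) = v + v⁻¹ →
      aeval (σ z) (C a * X + C b) = σ v + (σ v)⁻¹ := by
    intro σ z v h
    rw [aeval_algEquiv_apply, h, map_add, map_inv₀]
  have hσ0 : ∀ σ : L ≃ₐ[RatFunc ℂ] L, σ y ≠ 0 := fun σ ↦ by simpa using hy0
  have hfaith : ∀ σ : L ≃ₐ[RatFunc ℂ] L, σ y = y → σ = 1 := by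
    intro σ hfix
    refine algEquiv_eq_one (f := f) hf0 fun z hz ↦ hinj ?_
    obtain ⟨v, hv0, hv⟩ := exists_add_inv_eq hf h₂ hl hz
    rw [hσ σ hv, hv]
    have : σ v = v := by
      obtain ⟨i, rfl | rfl⟩ := hroots hz hv0 hv
      · rw [map_mul, map_pow, algEquiv_algebraMap, hfix]
      · rw [map_mul, map_pow, algEquiv_algebraMap, map_inv₀, hfix]
    rw [this]
  have hor : ∀ (σ : L ≃ₐ[RatFunc ℂ] L) {v : L}, v ≠ 0 →
      aeval (σ x) (C a * X + C b) = v + v⁻¹ → σ y = v ∨ σ y = v⁻¹ := by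
    intro σ v hv h
    have h' := (hσ σ hxy).symm.trans h
    have h1 := mul_inv_cancel₀ hv
    have h2 := mul_inv_cancel₀ (hσ0 σ)
    have : (σ y - v) * (σ y - v⁻¹) = 0 := by linear_combination σ y * h' + h1 - h2
    exact (mul_eq_zero.1 this).imp sub_eq_zero.1 sub_eq_zero.1
  obtain ⟨S, hS⟩ : ∃ S : L ≃ₐ[RatFunc ℂ] L, S y = y⁻¹ := by
    by_contra! hcon
    have hfix : ∀ σ : L ≃ₐ[RatFunc ℂ] L, σ x = x → σ y = y := fun σ h ↦
      (hor σ hy0 (by rw [h, hxy])).resolve_right (hcon σ)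
    have hpoly : ∀ v : L, v ^ 2 - aeval x (C a * X + C b) * v + 1 = 0 →
        (∀ σ : L ≃ₐ[RatFunc ℂ] L, σ x = x → σ v = v) → ∃ p : ℂ[X], aeval x p = v := by
      intro v hv hvfix
      refine exists_aeval_eq_of_isIntegral htr (mem_adjoin_root_of_fixed hf0 hx hvfix) ?_
      let W : Algebra.adjoin ℂ {x} := ⟨_, aeval_mem_adjoin_singleton ℂ x (p := C a * X + C b)⟩
      refine ⟨X ^ 2 - C W * X + 1, by monicity!, ?_⟩
      rw [← hv]
      simp [W]
    obtain ⟨p, hp⟩ := hpoly y (by rw [hxy]; field_simp; ring) hfix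
    obtain ⟨q, hq⟩ := hpoly y⁻¹ (by rw [hxy]; field_simp; ring)
      (fun σ h ↦ by rw [map_inv₀, hfix σ h])
    have hpq : p * q = 1 := transcendental_iff_injective.1 htr (by
      rw [map_mul, hp, hq, mul_inv_cancel₀ hy0, map_one])
    obtain ⟨c, -, rfl⟩ := isUnit_iff.1 (IsUnit.of_mul_eq_one q hpq)
    rw [aeval_C] at hp
    exact hytr (hp ▸ isAlgebraic_algebraMap c)
  have hζy : algebraMap ℂ L ζ * y ≠ 0 := mul_ne_zero (hζL.ne_zero hf0) hy0
  obtain ⟨R, hR⟩ : ∃ R : L ≃ₐ[RatFunc ℂ] L, R y = algebraMap ℂ L ζ * y := by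
    obtain ⟨z, hz⟩ : ∃ z : L, aeval z (C a * X + C b) =
        algebraMap ℂ L ζ * y + (algebraMap ℂ L ζ * y)⁻¹ :=
      ⟨(algebraMap ℂ L ζ * y + (algebraMap ℂ L ζ * y)⁻¹ - algebraMap ℂ L b) / algebraMap ℂ L a, by
        simp only [map_add, map_mul, aeval_C, aeval_X]
        rw [mul_div_cancel₀ _ hA, sub_add_cancel]⟩
    obtain ⟨σ, rfl⟩ := exists_algEquiv_root hf0 hx (y := z) (by
      rw [← hx, hcheb hζy hy0 hz hxy, inv_pow, inv_pow, mul_pow, hζL.pow_eq_one, one_mul])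
    rcases hor σ hζy hz with h | h
    · exact ⟨σ, h⟩
    · exact ⟨σ * S, by rw [AlgEquiv.mul_apply, hS, map_inv₀, h, inv_inv]⟩
  exact nonempty_mulEquiv_dihedralGroup hζ hytr hfaith
    (fun σ ↦ hroots (aeval_algEquiv_root σ hx) (hσ0 σ) (hσ σ hxy)) hR hS hf0
end Monodromy

theorem monodromy_cyclic_dihedral
    (f : ℂ[X]) (n : ℕ) (hn : f.natDegree = n) (h1 : 1 < n) :
    (IsCyclic (monPoly f).Gal ↔ CyclicPoly f) ∧
    (CyclicPoly f → Nat.card (monPoly f).Gal = n) ∧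
    (2 < n →
      ((∃ m : ℕ, Nonempty ((monPoly f).Gal ≃* DihedralGroup m)) ↔ DihedralPoly f) ∧
      (DihedralPoly f →
        Nat.card (monPoly f).Gal = 2 * n ∧
        Nonempty ((monPoly f).Gal ≃* DihedralGroup n))) := by
  subst hn
  have hf0 : f.natDegree ≠ 0 := by omega
  obtain ⟨x, hx⟩ := exists_root_monPoly (L := (monPoly f).SplittingField) hf0
  have hdih : 2 < f.natDegree → DihedralPoly f →
      Nonempty ((monPoly f).Gal ≃* DihedralGroup f.natDegree) :=
    nonempty_mulEquiv_of_dihedralPoly (L := (monPoly f).SplittingField)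
  refine ⟨⟨fun hc ↦ ?_, fun h ↦ ?_⟩, fun h ↦ ?_, fun h2 ↦ ⟨⟨?_, fun h ↦ ⟨_, hdih h2 h⟩⟩,
    fun h ↦ ⟨?_, hdih h2 h⟩⟩⟩
  · have : IsCyclic ((monPoly f).SplittingField ≃ₐ[RatFunc ℂ] (monPoly f).SplittingField) := hc
    exact (isCyclic_and_cyclicPoly_of_regular h1 hx (regular_of_isCyclic hf0 hx)).2
  · exact (isCyclic_and_cyclicPoly_of_regular h1 hx (regular_of_cyclicPoly hf0 h hx)).1
  · exact card_algEquiv_of_regular hf0 hx (regular_of_cyclicPoly hf0 h hx)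
  · rintro ⟨m, ⟨e⟩⟩
    exact dihedralPoly_of_mulEquiv (L := (monPoly f).SplittingField) h2 e
  · obtain ⟨e⟩ := hdih h2 h
    rw [Nat.card_congr e.toEquiv, DihedralGroup.nat_card]
end

section
/- Let m, n > 1 be coprime integers and let A_1,…,A_k and B_1,…,B_k be multisets of positive integers such that for each i, at least one of A_i, B_i contains an element greater than 1. Assume: (H1) for each 1 ≤ i ≤ k, the sum of the elements of A_i is n and the sum of the elements of B_i is m; (H2) Σ_{i=1}^k (n − |A_i|) = n − 1 = Σ_{i=1}^k Σ_{α ∈ A_i} Σ_{β ∈ B_i} (α − gcd(α,β)); (H3) Σ_{i=1}^k (m − |B_i|) = m − 1 = Σ_{i=1}^k Σ_{α ∈ A_i} Σ_{β ∈ B_i} (β − gcd(α,β)). Then one of the following holds: (C1) for some i, A_i = {n}, exactly one element of B_i is coprime to n, and all other elements of B_i are divisible by n; (C2) for some i, B_i = {m}, exactly one element of A_i is coprime to m, and all other elements of A_i are divisible by m; (C3) k = 2 and every element of A_1 ∪ A_2 ∪ B_1 ∪ B_2 is at most 2. -/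
/-- The sum of `α - gcd α β` over all `α ∈ A` and `β ∈ B`. -/
def gcdDefect (A B : Multiset ℕ) : ℕ :=
  (A.map fun α => (B.map fun β => α - Nat.gcd α β).sum).sum

theorem gcdDefect_cons_left (a : ℕ) (A B : Multiset ℕ) :
    gcdDefect (a ::ₘ A) B = (B.map fun β => a - Nat.gcd a β).sum + gcdDefect A B := by
  simp [gcdDefect]

theorem gcdDefect_cons_right (b : ℕ) (A B : Multiset ℕ) :
    gcdDefect A (b ::ₘ B) = (A.map fun α => α - Nat.gcd α b).sum + gcdDefect A B := by
  simp [gcdDefect, Multiset.sum_map_add]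

theorem gcdDefect_swap (A B : Multiset ℕ) :
    (A.map fun α => (B.map fun β => β - Nat.gcd α β).sum).sum = gcdDefect B A := by
  rw [gcdDefect, Multiset.sum_map_sum_map]
  simp only [Nat.gcd_comm]

theorem Multiset.card_le_sum_of_pos {A : Multiset ℕ} (hA : ∀ x ∈ A, 0 < x) :
    card A ≤ A.sum := by
  simpa using Multiset.card_nsmul_le_sum (s := A) (a := 1) hA

theorem Multiset.card_lt_sum_of_one_lt {A : Multiset ℕ} (hA : ∀ x ∈ A, 0 < x) {x : ℕ}
    (hx : x ∈ A) (h : 1 < x) : card A < A.sum := by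
  obtain ⟨A', rfl⟩ := Multiset.exists_cons_of_mem hx
  have := Multiset.card_le_sum_of_pos (A := A') fun y hy => hA y (Multiset.mem_cons_of_mem hy)
  simp only [Multiset.card_cons, Multiset.sum_cons]
  omega

theorem Multiset.exists_one_lt_of_card_lt_sum {A : Multiset ℕ} (h : card A < A.sum) :
    ∃ x ∈ A, 1 < x := by
  by_contra! hA
  have := Multiset.sum_le_card_nsmul A 1 hA
  simp only [smul_eq_mul, mul_one] at this
  omega

theorem Multiset.two_mul_card_le_count_one_add_sum {A : Multiset ℕ} (hA : ∀ x ∈ A, 0 < x) :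
    2 * card A ≤ A.count 1 + A.sum := by
  induction A using Multiset.induction_on with
  | empty => simp
  | cons a A ih =>
    have ih := ih fun y hy => hA y (Multiset.mem_cons_of_mem hy)
    have ha := hA a (Multiset.mem_cons_self a A)
    rw [Multiset.count_cons, Multiset.card_cons, Multiset.sum_cons]
    split_ifs <;> omega

theorem Multiset.two_mul_card_add_le_of_mem {A : Multiset ℕ} (hA : ∀ x ∈ A, 0 < x) {x : ℕ}
    (hx : x ∈ A) : 2 * card A + x ≤ A.count 1 + A.sum + 2 := by
  obtain ⟨A', rfl⟩ := Multiset.exists_cons_of_mem hx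
  have := Multiset.two_mul_card_le_count_one_add_sum (A := A')
    fun y hy => hA y (Multiset.mem_cons_of_mem hy)
  rw [Multiset.count_cons, Multiset.card_cons, Multiset.sum_cons]
  omega

theorem sum_sub_gcd_one {A : Multiset ℕ} (hA : ∀ x ∈ A, 0 < x) :
    (A.map fun α => α - Nat.gcd α 1).sum = A.sum - A.card := by
  induction A using Multiset.induction_on with
  | empty => simp
  | cons a A ih =>
    have hA' : ∀ x ∈ A, 0 < x := fun y hy => hA y (Multiset.mem_cons_of_mem hy)
    have ih := ih hA'
    have ha := hA a (Multiset.mem_cons_self a A)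
    have := Multiset.card_le_sum_of_pos hA'
    rw [Multiset.map_cons, Multiset.card_cons, Multiset.sum_cons, Multiset.sum_cons, ih,
      Nat.gcd_one_right]
    omega

theorem count_one_mul_le_gcdDefect {A : Multiset ℕ} (hA : ∀ x ∈ A, 0 < x) (B : Multiset ℕ) :
    B.count 1 * (A.sum - A.card) ≤ gcdDefect A B := by
  induction B using Multiset.induction_on with
  | empty => simp
  | cons b B ih =>
    rw [gcdDefect_cons_right, Multiset.count_cons]
    split_ifs with h
    · subst h
      rw [sum_sub_gcd_one hA, add_mul, one_mul]
      omega
    · rw [add_zero]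
      omega

theorem two_mul_card_le_sum_add_gcdDefect {A B : Multiset ℕ} (hA : ∃ x ∈ A, 1 < x)
    (hB : ∀ x ∈ B, 0 < x) : 2 * B.card ≤ B.sum + gcdDefect A B := by
  obtain ⟨x, hx, hx1⟩ := hA
  obtain ⟨A', rfl⟩ := Multiset.exists_cons_of_mem hx
  induction B using Multiset.induction_on with
  | empty => simp
  | cons b B ih =>
    have ih := ih fun y hy => hB y (Multiset.mem_cons_of_mem hy)
    have hb := hB b (Multiset.mem_cons_self b B)
    rw [gcdDefect_cons_right, Multiset.card_cons, Multiset.sum_cons, Multiset.map_cons,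
      Multiset.sum_cons]
    have := Nat.gcd_le_right x hb
    omega

theorem two_mul_gcd_le_or_dvd {n : ℕ} (hn : 0 < n) (b : ℕ) : 2 * Nat.gcd n b ≤ n ∨ n ∣ b := by
  obtain ⟨c, hc⟩ := Nat.gcd_dvd_left n b
  rcases Nat.lt_or_ge c 2 with h | h
  · right
    interval_cases c
    · omega
    · exact Nat.gcd_eq_left_iff_dvd.mp (by omega)
  · left
    nlinarith

theorem exists_coprime_of_gcdDefect_singleton_le {n : ℕ} (hn : 1 < n) {B : Multiset ℕ}
    (hco : Nat.Coprime n B.sum) (h : gcdDefect {n} B ≤ n - 1) :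
    ∃ (β : ℕ) (B' : Multiset ℕ), B = β ::ₘ B' ∧ Nat.Coprime β n ∧ ∀ b ∈ B', n ∣ b := by
  have hB : ∃ β ∈ B, ¬ n ∣ β := by
    by_contra! hB
    have := Nat.eq_one_of_dvd_coprimes hco dvd_rfl (Multiset.dvd_sum hB)
    omega
  obtain ⟨β, hβ, hnβ⟩ := hB
  obtain ⟨B', rfl⟩ := Multiset.exists_cons_of_mem hβ
  have hβ2 := (two_mul_gcd_le_or_dvd (by omega : 0 < n) β).resolve_right hnβ
  have hB' : ∀ b ∈ B', n ∣ b := by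
    intro b hb
    obtain ⟨B'', rfl⟩ := Multiset.exists_cons_of_mem hb
    rw [gcdDefect_cons_right, gcdDefect_cons_right] at h
    simp only [Multiset.map_singleton, Multiset.sum_singleton] at h
    refine (two_mul_gcd_le_or_dvd (by omega : 0 < n) b).resolve_left fun hb2 => ?_
    omega
  refine ⟨β, B', rfl, ?_, hB'⟩
  rw [Multiset.sum_cons] at hco
  refine Nat.eq_one_of_dvd_coprimes hco (Nat.gcd_dvd_right β n) ?_
  exact dvd_add (Nat.gcd_dvd_left β n)
    ((Nat.gcd_dvd_right β n).trans (Multiset.dvd_sum hB'))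

theorem le_of_gcdDefect_le {A B : Multiset ℕ} (hB : ∀ x ∈ B, 0 < x)
    (h1 : 1 ∈ A) {x : ℕ} (hx : x ∈ A) (hx1 : 1 < x)
    (h : gcdDefect B A ≤ B.sum - B.card) : ∀ β ∈ B, β ≤ x := by
  obtain ⟨A', rfl⟩ := Multiset.exists_cons_of_mem h1
  obtain ⟨A'', rfl⟩ := Multiset.exists_cons_of_mem
    ((Multiset.mem_cons.mp hx).resolve_left (by omega))
  rw [gcdDefect_cons_right, gcdDefect_cons_right, sum_sub_gcd_one hB] at h
  intro β hβ
  have h0 : (B.map fun β => β - Nat.gcd β x).sum = 0 := by omega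
  have := Multiset.sum_eq_zero_iff.mp h0 _ (Multiset.mem_map_of_mem _ hβ)
  have := Nat.gcd_le_right β (by omega : 0 < x)
  omega

theorem two_le_of_ne {α β : ℕ} (hα : 2 ≤ α) (hβ : 2 ≤ β) (h : α ≠ β) :
    2 ≤ (α - Nat.gcd α β) + (β - Nat.gcd β α) := by
  rw [Nat.gcd_comm β α]
  have h1 := Nat.gcd_le_left β (by omega : 0 < α)
  have h2 := Nat.gcd_le_right α (by omega : 0 < β)
  rcases two_mul_gcd_le_or_dvd (by omega : 0 < α) β with h3 | h3
  · rcases two_mul_gcd_le_or_dvd (by omega : 0 < β) α with h4 | h4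
    · rw [Nat.gcd_comm] at h4
      omega
    · have := Nat.le_of_dvd (by omega) h4
      omega
  · rcases two_mul_gcd_le_or_dvd (by omega : 0 < β) α with h4 | h4
    · rw [Nat.gcd_comm] at h4
      have := Nat.le_of_dvd (by omega) h3
      omega
    · exact absurd (Nat.dvd_antisymm h3 h4) h

theorem two_lt_gcdDefect_add_gcdDefect {A B : Multiset ℕ} (hA : ∀ x ∈ A, 2 ≤ x)
    (hB : ∀ x ∈ B, 2 ≤ x) (hAc : 2 ≤ A.card) (hBc : 2 ≤ B.card)
    (hco : Nat.Coprime A.sum B.sum) : 2 < gcdDefect A B + gcdDefect B A := by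
  by_contra! hle
  have hex : ∃ α ∈ A, ∃ β ∈ B, α ≠ β := by
    by_contra! hall
    obtain ⟨α, hα⟩ := Multiset.card_pos_iff_exists_mem.mp (by omega : 0 < A.card)
    obtain ⟨β, hβ⟩ := Multiset.card_pos_iff_exists_mem.mp (by omega : 0 < B.card)
    have h1 : α ∣ A.sum := Multiset.dvd_sum fun x hx => by
      rw [hall x hx β hβ, hall α hα β hβ]
    have h2 : α ∣ B.sum := Multiset.dvd_sum fun x hx => by rw [hall α hα x hx]
    have := Nat.eq_one_of_dvd_coprimes hco h1 h2
    have := hA α hα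
    omega
  obtain ⟨α, hα, β, hβ, hne⟩ := hex
  obtain ⟨A', rfl⟩ := Multiset.exists_cons_of_mem hα
  obtain ⟨B', rfl⟩ := Multiset.exists_cons_of_mem hβ
  rw [Multiset.card_cons] at hAc hBc
  obtain ⟨α', hα'⟩ := Multiset.card_pos_iff_exists_mem.mp (by omega : 0 < A'.card)
  obtain ⟨β', hβ'⟩ := Multiset.card_pos_iff_exists_mem.mp (by omega : 0 < B'.card)
  obtain ⟨A'', rfl⟩ := Multiset.exists_cons_of_mem hα'
  obtain ⟨B'', rfl⟩ := Multiset.exists_cons_of_mem hβ'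
  simp only [gcdDefect_cons_left, Multiset.map_cons, Multiset.sum_cons] at hle
  have a1 : 2 ≤ α := hA _ (by simp)
  have a2 : 2 ≤ α' := hA _ (by simp)
  have b1 : 2 ≤ β := hB _ (by simp)
  have b2 : 2 ≤ β' := hB _ (by simp)
  have c0 := two_le_of_ne a1 b1 hne
  have c1 : α = β' := by
    by_contra hc
    have := two_le_of_ne a1 b2 hc
    omega
  have c2 : α' = β' := by
    by_contra hc
    have := two_le_of_ne a2 b2 hc
    omega
  have c3 : α' = β := by
    by_contra hc
    have := two_le_of_ne a2 b1 hc
    omega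
  omega

theorem Finset.add_le_sum_univ {ι : Type*} [Fintype ι] (f : ι → ℕ) {i j : ι} (hij : i ≠ j) :
    f i + f j ≤ ∑ l, f l := by
  classical
  rw [← Finset.sum_pair hij]
  exact Finset.sum_le_sum_of_subset (Finset.subset_univ _)

/-- The hypotheses on the two families of multisets, arranged symmetrically. -/
structure GenusZeroData {ι : Type*} [Fintype ι] (n m : ℕ) (A B : ι → Multiset ℕ) : Prop where
  one_lt_left : 1 < n
  one_lt_right : 1 < m
  coprime : Nat.Coprime n m
  pos_left : ∀ i, ∀ x ∈ A i, 0 < x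
  pos_right : ∀ i, ∀ x ∈ B i, 0 < x
  nontrivial : ∀ i, (∃ x ∈ A i, 1 < x) ∨ (∃ x ∈ B i, 1 < x)
  sum_left : ∀ i, (A i).sum = n
  sum_right : ∀ i, (B i).sum = m
  sum_sub_card_left : ∑ i, (n - (A i).card) = n - 1
  sum_sub_card_right : ∑ i, (m - (B i).card) = m - 1
  sum_gcdDefect_left : ∑ i, gcdDefect (A i) (B i) = n - 1
  sum_gcdDefect_right : ∑ i, gcdDefect (B i) (A i) = m - 1

namespace GenusZeroData

variable {ι : Type*} [Fintype ι] {n m : ℕ} {A B : ι → Multiset ℕ}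

theorem symm (D : GenusZeroData n m A B) : GenusZeroData m n B A where
  one_lt_left := D.one_lt_right
  one_lt_right := D.one_lt_left
  coprime := D.coprime.symm
  pos_left := D.pos_right
  pos_right := D.pos_left
  nontrivial i := (D.nontrivial i).symm
  sum_left := D.sum_right
  sum_right := D.sum_left
  sum_sub_card_left := D.sum_sub_card_right
  sum_sub_card_right := D.sum_sub_card_left
  sum_gcdDefect_left := D.sum_gcdDefect_right
  sum_gcdDefect_right := D.sum_gcdDefect_left

theorem card_left_le (D : GenusZeroData n m A B) (i : ι) : (A i).card ≤ n :=
  D.sum_left i ▸ Multiset.card_le_sum_of_pos (D.pos_left i)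

theorem le_count_one_add (D : GenusZeroData n m A B) (i : ι) :
    n ≤ (A i).count 1 + 2 * (n - (A i).card) := by
  have h := Multiset.two_mul_card_le_count_one_add_sum (D.pos_left i)
  rw [D.sum_left i] at h
  have := D.card_left_le i
  omega

theorem count_one_mul_le (D : GenusZeroData n m A B) (i : ι) :
    (B i).count 1 * (n - (A i).card) ≤ gcdDefect (A i) (B i) := by
  have := count_one_mul_le_gcdDefect (D.pos_left i) (B i)
  rwa [D.sum_left i] at this

theorem exists_one_lt (D : GenusZeroData n m A B) {i : ι} (h : 0 < n - (A i).card) :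
    ∃ x ∈ A i, 1 < x :=
  Multiset.exists_one_lt_of_card_lt_sum (by rw [D.sum_left i]; omega)

theorem sub_card_pos (D : GenusZeroData n m A B) (i : ι) :
    0 < n - (A i).card ∨ 0 < m - (B i).card := by
  rcases D.nontrivial i with ⟨x, hx, h⟩ | ⟨x, hx, h⟩
  · have := Multiset.card_lt_sum_of_one_lt (D.pos_left i) hx h
    rw [D.sum_left i] at this
    omega
  · have := Multiset.card_lt_sum_of_one_lt (D.pos_right i) hx h
    rw [D.sum_right i] at this
    omega

/-- An index carrying the whole ramification of `A` gives the cyclic case. -/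
theorem cyclic_of_sub_card_eq (D : GenusZeroData n m A B) {i : ι}
    (h : n - (A i).card = n - 1) :
    A i = {n} ∧ ∃ (β : ℕ) (B' : Multiset ℕ),
      B i = β ::ₘ B' ∧ Nat.Coprime β n ∧ ∀ b ∈ B', n ∣ b := by
  have hn := D.one_lt_left
  have hc : (A i).card = 1 := by have := D.card_left_le i; omega
  obtain ⟨a, ha⟩ := Multiset.card_eq_one.mp hc
  have han : a = n := by have := D.sum_left i; rwa [ha, Multiset.sum_singleton] at this
  subst han
  refine ⟨ha, ?_⟩
  have hF := D.sum_gcdDefect_left ▸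
    Finset.single_le_sum (f := fun i => gcdDefect (A i) (B i)) (fun _ _ => Nat.zero_le _)
      (Finset.mem_univ i)
  refine exists_coprime_of_gcdDefect_singleton_le hn ?_ (by simpa [ha] using hF)
  rw [D.sum_right i]
  exact D.coprime

/-- If `i` and `j` carry the whole ramification of `A`, every other index carries none. -/
theorem sub_card_eq_zero (D : GenusZeroData n m A B) {i j l : ι} (hij : i ≠ j)
    (h : (n - (A i).card) + (n - (A j).card) = n - 1) (hi : l ≠ i) (hj : l ≠ j) :
    n - (A l).card = 0 := by
  classical
  have h3 : ∑ t ∈ {l, i, j}, (n - (A t).card) ≤ n - 1 :=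
    D.sum_sub_card_left ▸ Finset.sum_le_sum_of_subset (Finset.subset_univ _)
  rw [Finset.sum_insert (by simp [hi, hj]), Finset.sum_pair hij] at h3
  omega

theorem cyclic_or_dihedral_of_one_mem (D : GenusZeroData n m A B) {i j : ι} (hij : i ≠ j)
    (hi : 0 < n - (A i).card) (hj : 0 < n - (A j).card)
    (h : (n - (A i).card) + (n - (A j).card) = n - 1) (hi1 : 1 ∈ A i) (hj1 : 1 ∈ A j) :
    (∃ i, B i = {m} ∧ ∃ (α : ℕ) (A' : Multiset ℕ),
      A i = α ::ₘ A' ∧ Nat.Coprime α m ∧ ∀ a ∈ A', m ∣ a) ∨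
    (Fintype.card ι = 2 ∧ ∀ i, (∀ x ∈ A i, x ≤ 2) ∧ (∀ x ∈ B i, x ≤ 2)) := by
  classical
  have hn := D.one_lt_left
  have hcount : ∀ l, l ≠ i → l ≠ j → n ≤ (A l).count 1 := fun l hli hlj => by
    have := D.le_count_one_add l
    rw [D.sub_card_eq_zero hij h hli hlj] at this
    omega
  have hone : ∀ l, 1 ≤ (A l).count 1 := fun l => by
    by_cases hli : l = i
    · exact hli ▸ Multiset.one_le_count_iff_mem.mpr hi1
    by_cases hlj : l = j
    · exact hlj ▸ Multiset.one_le_count_iff_mem.mpr hj1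
    have := hcount l hli hlj
    omega
  have hle : ∀ l, m - (B l).card ≤ gcdDefect (B l) (A l) := fun l =>
    (Nat.le_mul_of_pos_left _ (hone l)).trans (D.symm.count_one_mul_le l)
  have heq : ∀ l, m - (B l).card = gcdDefect (B l) (A l) := fun l =>
    (Finset.sum_eq_sum_iff_of_le fun l _ => hle l).mp
      (D.sum_sub_card_right.trans D.sum_gcdDefect_right.symm) l (Finset.mem_univ l)
  have hcover : ∀ l, l = i ∨ l = j := fun l => by
    by_contra! hl
    have h0 := D.sub_card_eq_zero hij h hl.1 hl.2
    have hb := (D.sub_card_pos l).resolve_left (by omega)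
    have hG := D.symm.count_one_mul_le l
    rw [← heq l] at hG
    have := hcount l hl.1 hl.2
    nlinarith
  have huniv : (Finset.univ : Finset ι) = {i, j} := by
    ext l
    simpa using hcover l
  have hsum : (m - (B i).card) + (m - (B j).card) = m - 1 := by
    rw [← Finset.sum_pair hij (f := fun l => m - (B l).card), ← huniv]
    exact D.sum_sub_card_right
  by_cases hbi : m - (B i).card = 0
  · exact Or.inl ⟨j, D.symm.cyclic_of_sub_card_eq (by omega)⟩
  by_cases hbj : m - (B j).card = 0
  · exact Or.inl ⟨i, D.symm.cyclic_of_sub_card_eq (by omega)⟩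
  refine Or.inr ⟨by rw [← Finset.card_univ, huniv, Finset.card_pair hij], ?_⟩
  have hcount_eq : ∀ l, (A l).count 1 = 1 := fun l => by
    have hb : 0 < m - (B l).card := by rcases hcover l with rfl | rfl <;> omega
    have hG := D.symm.count_one_mul_le l
    rw [← heq l] at hG
    have := hone l
    have : (A l).count 1 ≤ 1 := by
      by_contra! hc
      nlinarith
    omega
  have hi2 := D.le_count_one_add i
  have hj2 := D.le_count_one_add j
  rw [hcount_eq] at hi2 hj2
  intro l
  have hl2 : 1 + 2 * (n - (A l).card) = n := by rcases hcover l with rfl | rfl <;> omega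
  have hA : ∀ x ∈ A l, x ≤ 2 := fun x hx => by
    have := Multiset.two_mul_card_add_le_of_mem (D.pos_left l) hx
    rw [hcount_eq, D.sum_left l] at this
    omega
  obtain ⟨x, hx, hx1⟩ := D.exists_one_lt (i := l) (by omega)
  refine ⟨hA, fun β hβ => (le_of_gcdDefect_le (D.pos_right l)
    (Multiset.one_le_count_iff_mem.mp (hone l)) hx hx1 ?_ β hβ).trans (hA x hx)⟩
  rw [D.sum_right l, heq l]

theorem two_le_of_one_notMem (D : GenusZeroData n m A B) {j : ι} (h1 : 1 ∉ A j) :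
    ∀ x ∈ A j, 2 ≤ x := fun x hx => by
  have := D.pos_left j x hx
  have : x ≠ 1 := fun h => h1 (h ▸ hx)
  omega

theorem le_two_mul_sub_card (D : GenusZeroData n m A B) {j : ι} (h1 : 1 ∉ A j) :
    n ≤ 2 * (n - (A j).card) := by
  have := D.le_count_one_add j
  rwa [Multiset.count_eq_zero_of_notMem h1, zero_add] at this

theorem one_mem_of_one_notMem (D : GenusZeroData n m A B) (hnm : n < m) {i j : ι} (hij : i ≠ j)
    (hi : 0 < n - (A i).card)
    (h : (n - (A i).card) + (n - (A j).card) = n - 1) (hj1 : 1 ∉ A j) : 1 ∈ B j := by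
  by_contra hBj
  have hn := D.one_lt_left
  have hF : gcdDefect (A i) (B i) + gcdDefect (A j) (B j) ≤ n - 1 :=
    D.sum_gcdDefect_left ▸ Finset.add_le_sum_univ (fun l => gcdDefect (A l) (B l)) hij
  have hG : gcdDefect (B i) (A i) + gcdDefect (B j) (A j) ≤ m - 1 :=
    D.sum_gcdDefect_right ▸ Finset.add_le_sum_univ (fun l => gcdDefect (B l) (A l)) hij
  have hb : (m - (B i).card) + (m - (B j).card) ≤ m - 1 :=
    D.sum_sub_card_right ▸ Finset.add_le_sum_univ (fun l => m - (B l).card) hij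
  have ha2 := D.le_two_mul_sub_card hj1
  have hb2 := D.symm.le_two_mul_sub_card hBj
  have hu := D.le_count_one_add i
  have hv := D.symm.le_count_one_add i
  have hF1 := D.count_one_mul_le i
  have hG1 := D.symm.count_one_mul_le i
  have hcA := D.card_left_le j
  have hcB := D.symm.card_left_le j
  have hAj : (A j).card = (n - (A i).card) + 1 := by omega
  have hBj' : (m - (B i).card) + 1 ≤ (B j).card := by omega
  generalize n - (A i).card = a at *
  generalize m - (B i).card = b at *
  have hb0 : 0 < b := by
    by_contra! hb0
    have : (B i).count 1 ≤ (B i).count 1 * a := Nat.le_mul_of_pos_right _ hi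
    omega
  have hlt := two_lt_gcdDefect_add_gcdDefect (D.two_le_of_one_notMem hj1)
    (D.symm.two_le_of_one_notMem hBj) (by omega) (by omega)
    (by rw [D.sum_left, D.sum_right]; exact D.coprime)
  obtain ⟨P, hP⟩ : ∃ P, n = 2 * a + 2 + P := ⟨n - (2 * a + 2), by omega⟩
  obtain ⟨Q, hQ⟩ : ∃ Q, m = 2 * b + 2 + Q := ⟨m - (2 * b + 2), by omega⟩
  have hu' : P + 2 ≤ (A i).count 1 := by omega
  have hv' : Q + 2 ≤ (B i).count 1 := by omega
  have h1 : (Q + 2) * a ≤ gcdDefect (A i) (B i) := (Nat.mul_le_mul_right a hv').trans hF1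
  have h2 : (P + 2) * b ≤ gcdDefect (B i) (A i) := (Nat.mul_le_mul_right b hu').trans hG1
  have h3 : Q ≤ Q * a := Nat.le_mul_of_pos_right _ hi
  have h4 : P ≤ P * b := Nat.le_mul_of_pos_right _ hb0
  rw [add_mul] at h1 h2
  omega

theorem cyclic_or_dihedral_of_one_notMem (D : GenusZeroData n m A B) (hnm : n < m) {i j : ι} (hij : i ≠ j)
    (hi : 0 < n - (A i).card)
    (h : (n - (A i).card) + (n - (A j).card) = n - 1) (hj1 : 1 ∉ A j) :
    (∃ i, A i = {n} ∧ ∃ (β : ℕ) (B' : Multiset ℕ),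
      B i = β ::ₘ B' ∧ Nat.Coprime β n ∧ ∀ b ∈ B', n ∣ b) ∨
    (Fintype.card ι = 2 ∧ ∀ i, (∀ x ∈ A i, x ≤ 2) ∧ (∀ x ∈ B i, x ≤ 2)) := by
  have hBj := D.one_mem_of_one_notMem hnm hij hi h hj1
  have hn := D.one_lt_left
  have hm := D.one_lt_right
  have hvj : 1 ≤ (B j).count 1 := Multiset.one_le_count_iff_mem.mpr hBj
  have ha2 := D.le_two_mul_sub_card hj1
  have hF : gcdDefect (A i) (B i) + gcdDefect (A j) (B j) ≤ n - 1 :=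
    D.sum_gcdDefect_left ▸ Finset.add_le_sum_univ (fun l => gcdDefect (A l) (B l)) hij
  have hb : (m - (B i).card) + (m - (B j).card) ≤ m - 1 :=
    D.sum_sub_card_right ▸ Finset.add_le_sum_univ (fun l => m - (B l).card) hij
  have hFi := D.count_one_mul_le i
  have hFj := D.count_one_mul_le j
  have hvi := D.symm.le_count_one_add i
  have hvj2 := D.symm.le_count_one_add j
  have hvj1 : (B j).count 1 = 1 := by
    by_contra hc
    have := Nat.mul_le_mul_right (n - (A j).card) (by omega : 2 ≤ (B j).count 1)
    omega
  rw [hvj1] at hFj hvj2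
  have hvi1 : (B i).count 1 = 1 := by
    by_contra hc
    have := Nat.mul_le_mul_right (n - (A i).card) (by omega : 2 ≤ (B i).count 1)
    omega
  rw [hvi1] at hvi
  have hBi : 1 ∈ B i := Multiset.one_le_count_iff_mem.mp hvi1.ge
  refine (D.symm.cyclic_or_dihedral_of_one_mem hij (by omega) (by omega) (by omega)
    hBi hBj).imp_right fun hC => ⟨hC.1, fun l => (hC.2 l).symm⟩

theorem card_ramified_le_two (D : GenusZeroData n m A B) (hnm : n < m) :
    (Finset.univ.filter fun i => 0 < n - (A i).card).card ≤ 2 := by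
  have hn := D.one_lt_left
  have hpt : ∀ i ∈ Finset.univ.filter fun i => 0 < n - (A i).card,
      m ≤ gcdDefect (A i) (B i) + 2 * (m - (B i).card) := fun i hi => by
    have := two_mul_card_le_sum_add_gcdDefect (D.exists_one_lt (Finset.mem_filter.mp hi).2)
      (D.pos_right i)
    rw [D.sum_right i] at this
    have := D.symm.card_left_le i
    omega
  have hsum := (Finset.card_nsmul_le_sum _ _ _ hpt).trans
    (Finset.sum_le_sum_of_subset (Finset.subset_univ _))
  rw [Finset.sum_add_distrib, ← Finset.mul_sum, D.sum_gcdDefect_left, D.sum_sub_card_right,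
    smul_eq_mul] at hsum
  by_contra! hc
  have := Nat.mul_le_mul_right m hc
  omega

theorem cyclic_or_dihedral_of_lt (D : GenusZeroData n m A B) (hnm : n < m) :
    (∃ i, A i = {n} ∧ ∃ (β : ℕ) (B' : Multiset ℕ),
      B i = β ::ₘ B' ∧ Nat.Coprime β n ∧ ∀ b ∈ B', n ∣ b) ∨
    (∃ i, B i = {m} ∧ ∃ (α : ℕ) (A' : Multiset ℕ),
      A i = α ::ₘ A' ∧ Nat.Coprime α m ∧ ∀ a ∈ A', m ∣ a) ∨
    (Fintype.card ι = 2 ∧ ∀ i, (∀ x ∈ A i, x ≤ 2) ∧ (∀ x ∈ B i, x ≤ 2)) := by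
  classical
  have hn := D.one_lt_left
  have hsum : ∑ i ∈ Finset.univ.filter (fun i => 0 < n - (A i).card), (n - (A i).card) = n - 1 := by
    rw [← D.sum_sub_card_left]
    refine Finset.sum_subset (Finset.filter_subset _ _) fun i _ hi => ?_
    simpa [Nat.sub_eq_zero_iff_le] using hi
  have hcard := D.card_ramified_le_two hnm
  have hmem : ∀ i ∈ Finset.univ.filter (fun i => 0 < n - (A i).card), 0 < n - (A i).card :=
    fun i hi => (Finset.mem_filter.mp hi).2
  generalize Finset.univ.filter (fun i => 0 < n - (A i).card) = S at *
  interval_cases hS : S.card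
  · rw [Finset.card_eq_zero.mp hS, Finset.sum_empty] at hsum
    omega
  · obtain ⟨i, rfl⟩ := Finset.card_eq_one.mp hS
    rw [Finset.sum_singleton] at hsum
    exact Or.inl ⟨i, D.cyclic_of_sub_card_eq hsum⟩
  · obtain ⟨i, j, hij, rfl⟩ := Finset.card_eq_two.mp hS
    rw [Finset.sum_pair hij] at hsum
    have hi := hmem i (by simp)
    have hj := hmem j (by simp)
    by_cases hj1 : 1 ∈ A j
    · by_cases hi1 : 1 ∈ A i
      · exact Or.inr (D.cyclic_or_dihedral_of_one_mem hij hi hj hsum hi1 hj1)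
      · exact (D.cyclic_or_dihedral_of_one_notMem hnm hij.symm hj (by omega) hi1).imp_right Or.inr
    · exact (D.cyclic_or_dihedral_of_one_notMem hnm hij hi hsum hj1).imp_right Or.inr

end GenusZeroData

theorem lemma_A
    (m n k : ℕ) (hm : 1 < m) (hn : 1 < n) (hco : Nat.Coprime m n)
    (A B : Fin k → Multiset ℕ)
    (hApos : ∀ i, ∀ x ∈ A i, 0 < x) (hBpos : ∀ i, ∀ x ∈ B i, 0 < x)
    (hbig : ∀ i, (∃ x ∈ A i, 1 < x) ∨ (∃ x ∈ B i, 1 < x))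
    (H1a : ∀ i, (A i).sum = n) (H1b : ∀ i, (B i).sum = m)
    (H2a : ∑ i, (n - Multiset.card (A i)) = n - 1)
    (H2b : ∑ i, ((A i).map
        (fun α => ((B i).map (fun β => α - Nat.gcd α β)).sum)).sum = n - 1)
    (H3a : ∑ i, (m - Multiset.card (B i)) = m - 1)
    (H3b : ∑ i, ((A i).map
        (fun α => ((B i).map (fun β => β - Nat.gcd α β)).sum)).sum = m - 1) :
    (∃ i, A i = {n} ∧ ∃ (β : ℕ) (B' : Multiset ℕ),
      B i = β ::ₘ B' ∧ Nat.Coprime β n ∧ ∀ b ∈ B', n ∣ b) ∨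
    (∃ i, B i = {m} ∧ ∃ (α : ℕ) (A' : Multiset ℕ),
      A i = α ::ₘ A' ∧ Nat.Coprime α m ∧ ∀ a ∈ A', m ∣ a) ∨
    (k = 2 ∧ ∀ i, (∀ x ∈ A i, x ≤ 2) ∧ (∀ x ∈ B i, x ≤ 2)) := by
  have D : GenusZeroData n m A B :=
    { one_lt_left := hn
      one_lt_right := hm
      coprime := hco.symm
      pos_left := hApos
      pos_right := hBpos
      nontrivial := hbig
      sum_left := H1a
      sum_right := H1b
      sum_sub_card_left := H2a
      sum_sub_card_right := H3a
      sum_gcdDefect_left := H2b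
      sum_gcdDefect_right := by simpa only [gcdDefect_swap] using H3b }
  rcases lt_trichotomy n m with h | h | h
  · simpa only [Fintype.card_fin] using D.cyclic_or_dihedral_of_lt h
  · subst h
    rw [Nat.coprime_self] at hco
    omega
  · rcases D.symm.cyclic_or_dihedral_of_lt h with h | h | ⟨h, h'⟩
    · exact Or.inr (Or.inl h)
    · exact Or.inl h
    · exact Or.inr (Or.inr ⟨by simpa only [Fintype.card_fin] using h, fun i => (h' i).symm⟩)
end
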